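/- arXiv:1109.4454 — 13 statements merged into one kernel-verified Lean document; each statement's English description precedes it below -/
import Mathlib

section
/- Let Σ be a finite set, P a row-stochastic matrix indexed by Σ, π a stationary distribution of P, and Π the square matrix each of whose rows equals π. Assume I − (P − Π) is invertible, and let N be a positive integer. Then I − ((1/N)P + (1 − 1/N)I − Π) is invertible and (I − ((1/N)P + (1 − 1/N)I − Π))⁻¹ − Π = N[(I − (P − Π))⁻¹ − Π]. -/
/-- fundamental-matrix identity for the lazy chain
`(1/N) P + (1 - 1/N) I`. -/
theorem fundamental_matrix_lazy_chain
    {S : Type*} [Fintype S] [DecidableEq S]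
    (P : Matrix S S ℝ) (hP0 : ∀ i j, 0 ≤ P i j) (hProw : ∀ i, ∑ j, P i j = 1)
    (π : S → ℝ) (hπ0 : ∀ i, 0 ≤ π i) (hπ1 : ∑ i, π i = 1)
    (hπP : ∀ j, ∑ i, π i * P i j = π j)
    (Pim : Matrix S S ℝ) (hPim : ∀ i j, Pim i j = π j)
    (hinv : IsUnit (1 - (P - Pim)))
    (N : ℕ) (hN : 1 ≤ N) :
    IsUnit (1 - (((N : ℝ)⁻¹ • P + (1 - (N : ℝ)⁻¹) • (1 : Matrix S S ℝ)) - Pim)) ∧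
    (1 - (((N : ℝ)⁻¹ • P + (1 - (N : ℝ)⁻¹) • (1 : Matrix S S ℝ)) - Pim))⁻¹ - Pim
      = (N : ℝ) • ((1 - (P - Pim))⁻¹ - Pim) := by
  have hPP : P * Pim = Pim := by
    ext i j
    simp only [Matrix.mul_apply, hPim]
    rw [← Finset.sum_mul, hProw, one_mul]
  have hQQ : Pim * Pim = Pim := by
    ext i j
    simp only [Matrix.mul_apply, hPim]
    rw [← Finset.sum_mul, hπ1, one_mul]
  have hQP : Pim * P = Pim := by
    ext i j
    simp only [Matrix.mul_apply, hPim]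
    exact hπP j
  have hdet := (Matrix.isUnit_iff_isUnit_det _).1 hinv
  have hN0 : (N : ℝ) ≠ 0 := by
    have : N ≠ 0 := by omega
    exact_mod_cast this
  have hAZ := Matrix.mul_nonsing_inv _ hdet
  generalize hA : 1 - (P - Pim) = A at *
  have hPA : P = 1 - A + Pim := by rw [← hA]; abel
  have hAQ : A * Pim = Pim := by
    rw [← hA]; simp only [sub_mul, one_mul, hPP, hQQ]; abel
  have hQA : Pim * A = Pim := by
    rw [← hA]; simp only [mul_sub, mul_one, hQP, hQQ]; abel
  have hQZ : Pim * A⁻¹ = Pim := by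
    calc Pim * A⁻¹ = (Pim * A) * A⁻¹ := by rw [hQA]
      _ = Pim := by rw [mul_assoc, hAZ, mul_one]
  have hB : 1 - (((N : ℝ)⁻¹ • P + (1 - (N : ℝ)⁻¹) • (1 : Matrix S S ℝ)) - Pim)
      = (N : ℝ)⁻¹ • (A - Pim) + Pim := by
    rw [hPA]; module
  rw [hB]
  have key : ((N : ℝ)⁻¹ • (A - Pim) + Pim) * ((N : ℝ) • (A⁻¹ - Pim) + Pim) = 1 := by
    have h1 : (A - Pim) * (A⁻¹ - Pim) = 1 - Pim := by
      simp only [sub_mul, mul_sub, hAZ, hAQ, hQZ, hQQ]; abel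
    have h2 : (A - Pim) * Pim = 0 := by rw [sub_mul, hAQ, hQQ, sub_self]
    have h3 : Pim * (A⁻¹ - Pim) = 0 := by rw [mul_sub, hQZ, hQQ, sub_self]
    rw [add_mul, mul_add, mul_add, Matrix.smul_mul, Matrix.mul_smul, Matrix.smul_mul,
      Matrix.mul_smul, h1, h2, h3, hQQ, smul_smul, inv_mul_cancel₀ hN0]
    module
  refine ⟨(Matrix.isUnit_iff_isUnit_det _).2 (Matrix.isUnit_det_of_right_inverse key), ?_⟩
  rw [Matrix.inv_eq_right_inv key]
  abel
end

section
/- If a, b, c are real numbers with 0 < a < b < c, then the sequence n ↦ (cⁿ − bⁿ)/(bⁿ − aⁿ) is strictly increasing in n for integers n ≥ 1. -/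
theorem aux_ineq (x y : ℝ) (hx : 0 < x) (hy : 0 < y) (hne : x ≠ y) (n : ℕ) (hn : 1 ≤ n) :
    0 < n * x ^ (n + 1) + y ^ (n + 1) - (n + 1) * y * x ^ n := by
  have hs : 0 < (x - y) ^ 2 := by
    have := sub_ne_zero.mpr hne
    positivity
  induction n, hn using Nat.le_induction with
  | base => norm_num; nlinarith
  | succ k hk ih =>
    have h1 := mul_pos hy ih
    have h2 : 0 < ((k : ℝ) + 1) * x ^ k * (x - y) ^ 2 := by positivity
    have h3 := add_pos h1 h2
    push_cast
    refine lt_of_lt_of_eq h3 ?_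
    ring

theorem aux_step (a b c : ℝ) (ha : 0 < a) (hab : a < b) (hbc : b < c) (n : ℕ) (hn : 1 ≤ n) :
    (c ^ n - b ^ n) / (b ^ n - a ^ n) < (c ^ (n + 1) - b ^ (n + 1)) / (b ^ (n + 1) - a ^ (n + 1)) := by
  have hb : 0 < b := ha.trans hab
  have hP : 0 < c ^ n - b ^ n := sub_pos.mpr (pow_lt_pow_left₀ hbc hb.le (by omega))
  have hQ : 0 < b ^ n - a ^ n := sub_pos.mpr (pow_lt_pow_left₀ hab ha.le (by omega))
  have hQ' : 0 < b ^ (n + 1) - a ^ (n + 1) :=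
    sub_pos.mpr (pow_lt_pow_left₀ hab ha.le (by omega))
  rw [div_lt_div_iff₀ hQ hQ']
  have h1 := mul_pos (aux_ineq c b (hb.trans hbc) hb hbc.ne' n hn) hQ
  have h2 := mul_pos (aux_ineq a b ha hb hab.ne n hn) hP
  have hn0 : (0 : ℝ) < n := by exact_mod_cast hn
  refine lt_of_mul_lt_mul_left (a := (n : ℝ)) ?_ hn0.le
  rw [← sub_pos]
  have h3 := add_pos h1 h2
  convert h3 using 1
  ring

/-- If `0 < a < b < c`, then `n ↦ (cⁿ − bⁿ)/(bⁿ − aⁿ)` is strictly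
increasing for integers `n ≥ 1`. -/
theorem ratio_strictMono (a b c : ℝ) (ha : 0 < a) (hab : a < b) (hbc : b < c) :
    StrictMonoOn (fun n : ℕ => (c ^ n - b ^ n) / (b ^ n - a ^ n)) (Set.Ici 1) := by
  intro n hn m _ hnm
  have hn1 : 1 ≤ n := hn
  have hle : n + 1 ≤ m := hnm
  clear hnm
  induction m, hle using Nat.le_induction with
  | base => exact aux_step a b c ha hab hbc n hn1
  | succ k hk ih =>
    have hk1 : 1 ≤ k := by omega
    exact (ih hk1).trans (aux_step a b c ha hab hbc k hk1)
end

section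
/- For all integers r, s ≥ 1, all integers N ≥ 2, and all ρ > 0, the quantity μ_{[r,s]}^{(N)} := N·E_{r,s}/D_{r,s} is positive if 0 < ρ < 1, zero if ρ = 1, and negative if ρ > 1. -/
noncomputable section ToralPattern

/-- `a_r := (1 − (1 − 3/N)^r)/3`. -/
def aR (N r : ℕ) : ℝ := (1 - (1 - 3 / (N : ℝ)) ^ r) / 3

/-- `S := √((1+ρ²)(1+4ρ+ρ²))`. -/
def Sq (ρ : ℝ) : ℝ := Real.sqrt ((1 + ρ ^ 2) * (1 + 4 * ρ + ρ ^ 2))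

/-- `e₁° := −1/2 + (1−ρ)S/(2(1+ρ)(1+ρ²))`. -/
def e1c (ρ : ℝ) : ℝ := -(1 / 2) + (1 - ρ) * Sq ρ / (2 * (1 + ρ) * (1 + ρ ^ 2))

/-- `e₂° := −1/2 − (1−ρ)S/(2(1+ρ)(1+ρ²))`. -/
def e2c (ρ : ℝ) : ℝ := -(1 / 2) - (1 - ρ) * Sq ρ / (2 * (1 + ρ) * (1 + ρ ^ 2))

/-- `e₁ := 1 − (1 − e₁°)/N`. -/
def e1 (N : ℕ) (ρ : ℝ) : ℝ := 1 - (1 - e1c ρ) / (N : ℝ)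

/-- `e₂ := 1 − (1 − e₂°)/N`. -/
def e2 (N : ℕ) (ρ : ℝ) : ℝ := 1 - (1 - e2c ρ) / (N : ℝ)

/-- The numerator `E_{r,s}`. -/
def Ers (N r s : ℕ) (ρ : ℝ) : ℝ :=
  3 * aR N r *
    ((2 + (3 * aR N r - 1) * (e1 N ρ ^ s + e2 N ρ ^ s - 2 * e1 N ρ ^ s * e2 N ρ ^ s)
        - (e1 N ρ ^ s + e2 N ρ ^ s)) * (1 - ρ) * (1 + ρ) * Sq ρ
      + aR N r * (e2 N ρ ^ s - e1 N ρ ^ s) * (5 * (1 + ρ) ^ 2 * (1 + ρ ^ 2) - 4 * ρ ^ 2))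
    * (1 - ρ) ^ 2

/-- The denominator `D_{r,s}`. -/
def Drs (N r s : ℕ) (ρ : ℝ) : ℝ :=
  4 * ((r : ℝ) + (s : ℝ)) * (1 + (3 * aR N r - 1) * e1 N ρ ^ s)
    * (1 + (3 * aR N r - 1) * e2 N ρ ^ s) * (1 + ρ + ρ ^ 2) ^ 2 * Sq ρ

/-- The mean profit per turn `μ_{[r,s]}^{(N)} := N·E_{r,s}/D_{r,s}`. -/
def muRS (N r s : ℕ) (ρ : ℝ) : ℝ := (N : ℝ) * Ers N r s ρ / Drs N r s ρ

end ToralPattern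

lemma geomH (e f d : ℝ) (he : 0 ≤ e) (hf : 0 ≤ f) (hd : 0 < d) (hde : d ≤ 1 - e)
    (hdf : d ≤ 1 - f) (s : ℕ) :
    ∃ h : ℝ, 0 ≤ h ∧ e ^ s - f ^ s = (e - f) * h ∧ d * h ≤ 1 - e ^ s ∧ d * h ≤ 1 - f ^ s ∧
      (e + f ≤ 1 → h ≤ 1) := by
  induction s with
  | zero => exact ⟨0, by simp⟩
  | succ n ih =>
    obtain ⟨h, h0, h1, h2, h3, h4⟩ := ih
    have hen : 0 ≤ e ^ n := pow_nonneg he n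
    have hfn : 0 ≤ f ^ n := pow_nonneg hf n
    have hen1 : e ^ n ≤ 1 := pow_le_one₀ he (by linarith)
    have hfn1 : f ^ n ≤ 1 := pow_le_one₀ hf (by linarith)
    refine ⟨e * h + f ^ n, by positivity, ?_, ?_, ?_, ?_⟩
    · rw [pow_succ, pow_succ]; linear_combination e * h1
    · rw [pow_succ]
      have a1 := mul_le_mul_of_nonneg_left h2 he
      have a2 := mul_le_mul_of_nonneg_left hfn1 hd.le
      linarith
    · have : e * h + f ^ n = f * h + e ^ n := by linarith
      rw [this, pow_succ]
      have a1 := mul_le_mul_of_nonneg_left h3 hf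
      have a2 := mul_le_mul_of_nonneg_left hen1 hd.le
      linarith
    · intro hef
      rcases n with _ | n
      · have h5 : d * h ≤ 0 := by simpa using h2
        have h6 : h = 0 := by nlinarith
        simp [h6]
      · have a1 := mul_le_mul_of_nonneg_left (h4 hef) he
        have a2 : f ^ (n + 1) ≤ f := pow_le_of_le_one hf (by linarith) (by simp)
        linarith

lemma core (b e f n K : ℝ) (s : ℕ) (hs : 1 ≤ s) (hn : 2 ≤ n) (hb1 : b < 1)
    (hb : 0 ≤ b ∨ (n = 2 ∧ -(1 / 2) ≤ b)) (hsum : e + f = 2 - 3 / n)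
    (he : e < 1 - 1 / n) (hf : f < 1 - 1 / n) (hK : K ≤ 5 / n) :
    (∃ h : ℝ, e ^ s - f ^ s = (e - f) * h ∧
      0 < 2 - b * (e ^ s + f ^ s - 2 * e ^ s * f ^ s) - (e ^ s + f ^ s) - (1 - b) / 3 * (K * h)) ∧
    0 < 1 - b * e ^ s ∧ 0 < 1 - b * f ^ s := by
  have hn0 : 0 < n := by linarith
  have hd : 0 < 1 / n := by positivity
  have hd2 : 1 / n ≤ 1 / 2 := one_div_le_one_div_of_le (by norm_num) hn
  have e3 : 3 / n = 3 * (1 / n) := by ring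
  have e5 : 5 / n = 5 * (1 / n) := by ring
  rw [e3] at hsum
  rw [e5] at hK
  have he0 : 0 < e := by linarith
  have hf0 : 0 < f := by linarith
  obtain ⟨h, h0, h1, h2, h3, h4⟩ := geomH e f (1 / n) he0.le hf0.le hd (by linarith) (by linarith) s
  have hx1 : e ^ s ≤ e := pow_le_of_le_one he0.le (by linarith) (by omega)
  have hy1 : f ^ s ≤ f := pow_le_of_le_one hf0.le (by linarith) (by omega)
  have hx0 : 0 < e ^ s := pow_pos he0 s
  have hy0 : 0 < f ^ s := pow_pos hf0 s
  have hKh : K * h ≤ 5 * (1 / n * h) := by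
    have := mul_le_mul_of_nonneg_right hK h0
    linarith
  set x := e ^ s
  set y := f ^ s
  have hx2 : x < 1 := by linarith
  have hy2 : y < 1 := by linarith
  have f0 : 0 < 2 - (x + y) - 1 / 3 * (K * h) := by linarith
  have f1 : 0 < 2 * ((1 - x) * (1 - y)) := by
    have := mul_pos (sub_pos.2 hx2) (sub_pos.2 hy2)
    linarith
  refine ⟨⟨h, h1, ?_⟩, by nlinarith [hb.elim (fun h => (by linarith : -(1/2) ≤ b)) (fun h => h.2)],
    by nlinarith [hb.elim (fun h => (by linarith : -(1/2) ≤ b)) (fun h => h.2)]⟩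
  rcases hb with hb | ⟨rfl, hb⟩
  · have a1 : 0 < (1 - b) * (2 - (x + y) - 1 / 3 * (K * h)) := mul_pos (by linarith) f0
    have a2 := mul_nonneg hb f1.le
    linarith
  · have h5 : h ≤ 1 := h4 (by linarith)
    have hxy : x * y ≤ 1 / 4 := by nlinarith
    have g0 : 0 < 2 - (x + y) / 2 - x * y - 1 / 2 * (K * h) := by linarith
    have a1 : 0 < (1 - b) * (2 - (x + y) / 2 - x * y - 1 / 2 * (K * h)) := mul_pos (by linarith) g0
    have a2 := mul_nonneg (by linarith : 0 ≤ b + 1 / 2) f1.le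
    linarith

lemma main_factor (r s N : ℕ) (hr : 1 ≤ r) (hs : 1 ≤ s) (hN : 2 ≤ N) (ρ : ℝ) (hρ : 0 < ρ) :
    ∃ c : ℝ, 0 < c ∧ muRS N r s ρ = c * (1 - ρ) ^ 3 := by
  have hn : (2 : ℝ) ≤ N := by exact_mod_cast hN
  have hn0 : (0 : ℝ) < N := by linarith
  set n : ℝ := (N : ℝ) with hnd
  have hS : 0 < Sq ρ := Real.sqrt_pos.2 (by positivity)
  have hS2 : Sq ρ ^ 2 = (1 + ρ ^ 2) * (1 + 4 * ρ + ρ ^ 2) := Real.sq_sqrt (by positivity)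
  have hM : 0 < (1 + ρ) * (1 + ρ ^ 2) := by positivity
  set t : ℝ := (1 - ρ) * Sq ρ / ((1 + ρ) * (1 + ρ ^ 2)) with ht
  have ht2 : t ^ 2 < 1 := by
    rw [ht, div_pow, div_lt_one (by positivity), mul_pow, hS2]
    have : 0 < 8 * ρ ^ 2 * (1 + ρ ^ 2) := by positivity
    nlinarith
  have htl : -1 < t := by nlinarith
  have htu : t < 1 := by nlinarith
  have he1 : e1 N ρ = 1 - 1 / n * (3 / 2 - t / 2) := by
    unfold e1 e1c; rw [ht]; field_simp; ring
  have he2 : e2 N ρ = 1 - 1 / n * (3 / 2 + t / 2) := by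
    unfold e2 e2c; rw [ht]; field_simp; ring
  have hd : 0 < 1 / n := by positivity
  set b : ℝ := (1 - 3 / n) ^ r with hbd
  have ha : aR N r = (1 - b) / 3 := rfl
  have hb : b < 1 ∧ (0 ≤ b ∨ (n = 2 ∧ -(1 / 2) ≤ b)) := by
    rcases Nat.lt_or_ge N 3 with h | h
    · have hN2 : N = 2 := by omega
      have hn2 : n = 2 := by rw [hnd, hN2]; norm_num
      have : |b| ≤ 1 / 2 := by
        rw [hbd, abs_pow, hn2]
        have : |(1 - 3 / 2 : ℝ)| = 1 / 2 := by rw [abs_of_neg] <;> norm_num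
        rw [this]
        exact pow_le_of_le_one (by norm_num) (by norm_num) (by omega)
      have := abs_le.1 this
      exact ⟨by linarith, Or.inr ⟨hn2, this.1⟩⟩
    · have h3 : (3 : ℝ) ≤ n := by rw [hnd]; exact_mod_cast h
      have h4 : 3 / n ≤ 1 := (div_le_one hn0).2 h3
      have h5 : 0 < 3 / n := by positivity
      exact ⟨pow_lt_one₀ (by linarith) (by linarith) (by omega),
        Or.inl (pow_nonneg (by linarith) _)⟩
  obtain ⟨hb1, hb2⟩ := hb
  set Q : ℝ := 5 * (1 + ρ) ^ 2 * (1 + ρ ^ 2) - 4 * ρ ^ 2 with hQ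
  set K : ℝ := Q / (n * ((1 + ρ) ^ 2 * (1 + ρ ^ 2))) with hKd
  have hK : K ≤ 5 / n := by
    rw [hKd, div_le_div_iff₀ (by positivity) hn0, hQ]
    have : 0 ≤ 4 * ρ ^ 2 * n := by positivity
    nlinarith
  obtain ⟨⟨h, h1, h2⟩, h3, h4⟩ := core b (e1 N ρ) (e2 N ρ) n K s hs hn hb1 hb2
    (by rw [he1, he2]; ring) (by rw [he1]; nlinarith) (by rw [he2]; nlinarith) hK
  have hdiff : (e1 N ρ - e2 N ρ) * Q = (1 - ρ) * (1 + ρ) * Sq ρ * K := by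
    rw [he1, he2, ht, hKd]; field_simp; ring
  set x := e1 N ρ ^ s with hx
  set y := e2 N ρ ^ s with hy
  set G := 2 - b * (x + y - 2 * x * y) - (x + y) - (1 - b) / 3 * (K * h) with hG
  have hE : Ers N r s ρ = (1 - b) * (G * (1 + ρ) * Sq ρ) * (1 - ρ) ^ 3 := by
    have h5 : (y - x) * Q = -((1 - ρ) * (1 + ρ) * Sq ρ * K * h) := by
      linear_combination (-Q) * h1 - h * hdiff
    unfold Ers
    rw [ha, ← hx, ← hy, ← hQ, hG]
    linear_combination (1 - b) * (1 - b) / 3 * (1 - ρ) ^ 2 * h5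
  have hD : 0 < Drs N r s ρ := by
    unfold Drs
    rw [ha, ← hx, ← hy]
    have e1' : 1 + (3 * ((1 - b) / 3) - 1) * x = 1 - b * x := by ring
    have e2' : 1 + (3 * ((1 - b) / 3) - 1) * y = 1 - b * y := by ring
    rw [e1', e2']
    have : (0 : ℝ) < r := by exact_mod_cast hr
    positivity
  refine ⟨n * ((1 - b) * (G * (1 + ρ) * Sq ρ)) / Drs N r s ρ, ?_, ?_⟩
  · have : 0 < 1 - b := by linarith
    positivity
  · unfold muRS
    rw [hE]; ring




/-- the Parrondo effect is present for every pattern `[r,s]`: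
`μ_{[r,s]}^{(N)}` is positive if `0 < ρ < 1`, zero if `ρ = 1`, negative if `ρ > 1`. -/
theorem muRS_sign (r s N : ℕ) (hr : 1 ≤ r) (hs : 1 ≤ s) (hN : 2 ≤ N)
    (ρ : ℝ) (hρ : 0 < ρ) :
    (ρ < 1 → 0 < muRS N r s ρ) ∧ (ρ = 1 → muRS N r s ρ = 0) ∧
      (1 < ρ → muRS N r s ρ < 0) := by
  obtain ⟨c, hc, h⟩ := main_factor r s N hr hs hN ρ hρ
  rw [h]
  refine ⟨fun h1 => ?_, fun h1 => ?_, fun h1 => ?_⟩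
  · have : 0 < 1 - ρ := by linarith
    positivity
  · simp [h1]
  · have : 0 < (ρ - 1) ^ 3 := pow_pos (by linarith) 3
    have := mul_pos hc this
    linarith
end

section
/- For all integers r, s ≥ 1, all integers N ≥ 2, and all ρ > 0, μ_{[r,s]}^{(N)} evaluated at 1/ρ equals the negative of μ_{[r,s]}^{(N)} evaluated at ρ; that is, writing μ_{[r,s]}^{(N)}(ρ) := N·E_{r,s}/D_{r,s}, one has μ_{[r,s]}^{(N)}(1/ρ) = −μ_{[r,s]}^{(N)}(ρ). -/
theorem aux_Sq (ρ : ℝ) (hρ : 0 < ρ) : Sq (1 / ρ) = Sq ρ / ρ ^ 2 := by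
  unfold Sq
  have h : (1 + (1 / ρ) ^ 2) * (1 + 4 * (1 / ρ) + (1 / ρ) ^ 2)
      = ((1 + ρ ^ 2) * (1 + 4 * ρ + ρ ^ 2)) / (ρ ^ 2) ^ 2 := by
    field_simp
    ring
  rw [h, Real.sqrt_div (by positivity), Real.sqrt_sq (by positivity)]

theorem aux_frac (ρ : ℝ) (hρ : 0 < ρ) :
    (1 - 1 / ρ) * Sq (1 / ρ) / (2 * (1 + 1 / ρ) * (1 + (1 / ρ) ^ 2))
      = -((1 - ρ) * Sq ρ / (2 * (1 + ρ) * (1 + ρ ^ 2))) := by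
  rw [aux_Sq ρ hρ]
  have h1 : (1 - 1 / ρ) * (Sq ρ / ρ ^ 2) = -((1 - ρ) * Sq ρ) / ρ ^ 3 := by
    field_simp
    ring
  have h2 : 2 * (1 + 1 / ρ) * (1 + (1 / ρ) ^ 2) = (2 * (1 + ρ) * (1 + ρ ^ 2)) / ρ ^ 3 := by
    field_simp
    ring
  rw [h1, h2, div_div_div_cancel_right₀ (by positivity), neg_div]

theorem aux_e1 (N : ℕ) (ρ : ℝ) (hρ : 0 < ρ) : e1 N (1 / ρ) = e2 N ρ := by
  unfold e1 e2 e1c e2c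
  rw [aux_frac ρ hρ, sub_eq_add_neg (-(1 / 2) : ℝ)]

theorem aux_e2 (N : ℕ) (ρ : ℝ) (hρ : 0 < ρ) : e2 N (1 / ρ) = e1 N ρ := by
  unfold e1 e2 e1c e2c
  rw [aux_frac ρ hρ, sub_neg_eq_add]

theorem aux_E (N r s : ℕ) (ρ : ℝ) (hρ : 0 < ρ) :
    Ers N r s (1 / ρ) = -Ers N r s ρ / ρ ^ 6 := by
  unfold Ers
  rw [aux_e1 N ρ hρ, aux_e2 N ρ hρ, aux_Sq ρ hρ]
  generalize e1 N ρ ^ s = x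
  generalize e2 N ρ ^ s = y
  generalize aR N r = a
  generalize Sq ρ = S
  field_simp
  ring

theorem aux_D (N r s : ℕ) (ρ : ℝ) (hρ : 0 < ρ) :
    Drs N r s (1 / ρ) = Drs N r s ρ / ρ ^ 6 := by
  unfold Drs
  rw [aux_e1 N ρ hρ, aux_e2 N ρ hρ, aux_Sq ρ hρ]
  generalize e1 N ρ ^ s = x
  generalize e2 N ρ ^ s = y
  generalize aR N r = a
  generalize Sq ρ = S
  have h : 1 + 1 / ρ + (1 / ρ) ^ 2 = (1 + ρ + ρ ^ 2) / ρ ^ 2 := by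
    field_simp
    ring
  rw [h]
  ring

/-- `μ_{[r,s]}^{(N)}(1/ρ) = −μ_{[r,s]}^{(N)}(ρ)`. -/
theorem muRS_inv_rho (r s N : ℕ) (hr : 1 ≤ r) (hs : 1 ≤ s) (hN : 2 ≤ N)
    (ρ : ℝ) (hρ : 0 < ρ) :
    muRS N r s (1 / ρ) = - muRS N r s ρ := by
  unfold muRS
  rw [aux_E N r s ρ hρ, aux_D N r s ρ hρ, ← mul_div_assoc,
    div_div_div_cancel_right₀ (by positivity), mul_neg, neg_div]
end

section
/- For all integers N ≥ 2 and s ≥ 1 and all real x with 0 < x ≤ 1, one has (2N−3+x)^s − (2N−3−x)^s > 0 and x·(2(2N)^s − (2N−3+x)^s − (2N−3−x)^s) / ((2N−3+x)^s − (2N−3−x)^s) > 5/2. -/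
/-- for `N ≥ 2`, `s ≥ 1`, `0 < x ≤ 1`, the denominator
`(2N−3+x)^s − (2N−3−x)^s` is positive and the key ratio exceeds `5/2`. -/
theorem key_inequality (N s : ℕ) (hN : 2 ≤ N) (hs : 1 ≤ s)
    (x : ℝ) (hx0 : 0 < x) (hx1 : x ≤ 1) :
    0 < (2 * (N : ℝ) - 3 + x) ^ s - (2 * (N : ℝ) - 3 - x) ^ s ∧
    5 / 2 < x * (2 * (2 * (N : ℝ)) ^ s - (2 * (N : ℝ) - 3 + x) ^ s
        - (2 * (N : ℝ) - 3 - x) ^ s)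
      / ((2 * (N : ℝ) - 3 + x) ^ s - (2 * (N : ℝ) - 3 - x) ^ s) := by
  have hN' : (2 : ℝ) ≤ N := by exact_mod_cast hN
  have hM : 0 ≤ 2 * (N : ℝ) - 3 - x := by linarith
  have hpos : 0 < (2 * (N : ℝ) - 3 + x) ^ s - (2 * (N : ℝ) - 3 - x) ^ s :=
    sub_pos.mpr (pow_lt_pow_left₀ (by linarith) hM (by omega))
  refine ⟨hpos, ?_⟩
  rw [lt_div_iff₀ hpos]
  have h3 : 0 < 3 + x := by linarith
  have hsum : 2 * x / (3 + x) + (3 - x) / (3 + x) = 1 := by field_simp; ring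
  have h2 : 0 ≤ 2 * x / (3 + x) := by positivity
  have hy : (2 * (N : ℝ)) ∈ Set.Ici (0 : ℝ) := Set.mem_Ici.mpr (by linarith)
  have hc := (convexOn_pow (𝕜 := ℝ) s).2 hy (Set.mem_Ici.mpr hM) h2
    (div_nonneg (by linarith) h3.le) hsum
  simp only [smul_eq_mul] at hc
  have he : 2 * x / (3 + x) * (2 * (N : ℝ)) + (3 - x) / (3 + x) * (2 * (N : ℝ) - 3 - x)
      = 2 * (N : ℝ) - 3 + x := by field_simp; ring
  rw [he] at hc
  have hm := mul_le_mul_of_nonneg_left hc h3.le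
  have he2 : (3 + x) * (2 * x / (3 + x) * (2 * (N : ℝ)) ^ s
      + (3 - x) / (3 + x) * (2 * (N : ℝ) - 3 - x) ^ s)
      = 2 * x * (2 * (N : ℝ)) ^ s + (3 - x) * (2 * (N : ℝ) - 3 - x) ^ s := by
    field_simp
  rw [he2] at hm
  linarith
end

section
/- For fixed integers N ≥ 2 and s ≥ 1, the function f(x) := x·(2(2N)^s − (2N−3+x)^s − (2N−3−x)^s) / ((2N−3+x)^s − (2N−3−x)^s) is nonincreasing on the interval (0, 1]. -/
theorem key_aux (a x y : ℝ) (ha : 1 ≤ a) (hx : 0 < x) (hxy : x ≤ y) (s : ℕ) :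
    ∃ p q : ℝ, (a + x) ^ s - (a - x) ^ s = x * p ∧ (a + y) ^ s - (a - y) ^ s = y * q ∧
      0 ≤ p ∧ p ≤ q ∧ 0 ≤ (a + x) ^ s + (a - x) ^ s ∧
      (a + x) ^ s + (a - x) ^ s ≤ (a + y) ^ s + (a - y) ^ s := by
  induction s with
  | zero => exact ⟨0, 0, by simp, by simp, le_refl _, le_refl _, by norm_num, by norm_num⟩
  | succ n ih =>
    obtain ⟨p, q, h1, h2, h3, h4, h5, h6⟩ := ih
    have e : ∀ z : ℝ, (a + z) ^ (n + 1) + (a - z) ^ (n + 1) =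
        a * ((a + z) ^ n + (a - z) ^ n) + z * ((a + z) ^ n - (a - z) ^ n) := by
      intro z; ring
    have e' : ∀ z : ℝ, (a + z) ^ (n + 1) - (a - z) ^ (n + 1) =
        a * ((a + z) ^ n - (a - z) ^ n) + z * ((a + z) ^ n + (a - z) ^ n) := by
      intro z; ring
    refine ⟨a * p + ((a + x) ^ n + (a - x) ^ n), a * q + ((a + y) ^ n + (a - y) ^ n),
      ?_, ?_, ?_, ?_, ?_, ?_⟩
    · rw [e', h1]; ring
    · rw [e', h2]; ring
    · positivity
    · gcongr
    · rw [e, h1]; positivity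
    · rw [e, e, h1, h2]
      have : 0 ≤ y := by linarith
      gcongr

/-- for fixed `N ≥ 2` and `s ≥ 1`, the function
`f(x) = x(2(2N)^s − (2N−3+x)^s − (2N−3−x)^s)/((2N−3+x)^s − (2N−3−x)^s)`
is nonincreasing on `(0, 1]`. -/
theorem key_ratio_antitone (N s : ℕ) (hN : 2 ≤ N) (hs : 1 ≤ s) :
    AntitoneOn (fun x : ℝ =>
      x * (2 * (2 * (N : ℝ)) ^ s - (2 * (N : ℝ) - 3 + x) ^ s
          - (2 * (N : ℝ) - 3 - x) ^ s)
        / ((2 * (N : ℝ) - 3 + x) ^ s - (2 * (N : ℝ) - 3 - x) ^ s))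
      (Set.Ioc 0 1) := by
  rintro x ⟨hx, hx1⟩ y ⟨hy, hy1⟩ hxy
  have hN' : (2 : ℝ) ≤ N := by exact_mod_cast hN
  have ha : 1 ≤ 2 * (N : ℝ) - 3 := by linarith
  obtain ⟨p, q, h1, h2, h3, h4, h5, h6⟩ := key_aux _ x y ha hx hxy s
  have hD : (2 * (N : ℝ) - 3 - x) ^ s < (2 * (N : ℝ) - 3 + x) ^ s :=
    pow_lt_pow_left₀ (by linarith) (by linarith) (by omega)
  have hp : 0 < p := by
    rcases h3.lt_or_eq with h | h
    · exact h
    · rw [← h] at h1; linarith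
  have b1 : (2 * (N : ℝ) - 3 + x) ^ s ≤ (2 * (N : ℝ)) ^ s :=
    pow_le_pow_left₀ (by linarith) (by linarith) s
  have b2 : (2 * (N : ℝ) - 3 - x) ^ s ≤ (2 * (N : ℝ)) ^ s :=
    pow_le_pow_left₀ (by linarith) (by linarith) s
  dsimp only
  rw [h1, h2, mul_div_mul_left _ _ hx.ne', mul_div_mul_left _ _ hy.ne']
  exact div_le_div₀ (by linarith) (by linarith) hp h4
end

section
/- For every ρ > 0, with π := ((1+ρ²)/(2(1+ρ+ρ²)), ρ(1+ρ)/(2(1+ρ+ρ²)), (1+ρ)/(2(1+ρ+ρ²))), Π the 3×3 matrix each of whose rows is π, the matrix I − (P_B − Π) is invertible with inverse Z, and one has πṖ_B1 = 0 and πP̈_B1 + 2πṖ_B(Z − Π)Ṗ_B1 = (3ρ/(1+ρ+ρ²))². -/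
open Matrix

noncomputable section ToralMatrices

/-- Transition matrix of Parrondo's game `B` (parameterization `(2)` with `ε = 0`):
rows `(0, p₀, q₀)`, `(q₁, 0, p₁)`, `(p₂, q₂, 0)` where `p₀ = ρ²/(1+ρ²)`,
`p₁ = p₂ = 1/(1+ρ)`. -/
def PB (ρ : ℝ) : Matrix (Fin 3) (Fin 3) ℝ :=
  !![0, ρ ^ 2 / (1 + ρ ^ 2), 1 - ρ ^ 2 / (1 + ρ ^ 2);
     1 - 1 / (1 + ρ), 0, 1 / (1 + ρ);
     1 / (1 + ρ), 1 - 1 / (1 + ρ), 0]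

/-- Transition matrix of Parrondo's original game `A` (a fair coin). -/
def PA : Matrix (Fin 3) (Fin 3) ℝ :=
  !![0, 1 / 2, 1 / 2;
     1 / 2, 0, 1 / 2;
     1 / 2, 1 / 2, 0]

/-- The payoff matrix `W`. -/
def W : Matrix (Fin 3) (Fin 3) ℝ :=
  !![0, 1, -1;
     -1, 0, 1;
     1, -1, 0]

/-- The stationary distribution of `PB`. -/
def piB (ρ : ℝ) : Fin 3 → ℝ :=
  ![(1 + ρ ^ 2) / (2 * (1 + ρ + ρ ^ 2)),
    ρ * (1 + ρ) / (2 * (1 + ρ + ρ ^ 2)),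
    (1 + ρ) / (2 * (1 + ρ + ρ ^ 2))]

end ToralMatrices

/-- The matrix each of whose rows is `piB ρ`. -/
noncomputable def PiMat (ρ : ℝ) : Matrix (Fin 3) (Fin 3) ℝ :=
  Matrix.of fun _ j => piB ρ j

/-- `Ṗ_B := P_B ∘ W` (Hadamard product). -/
noncomputable def PBdot (ρ : ℝ) : Matrix (Fin 3) (Fin 3) ℝ :=
  Matrix.of fun i j => PB ρ i j * W i j

/-- `P̈_B := P_B ∘ W ∘ W` (Hadamard product). -/
noncomputable def PBddot (ρ : ℝ) : Matrix (Fin 3) (Fin 3) ℝ :=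
  Matrix.of fun i j => PB ρ i j * W i j * W i j

/-- Solution of the Poisson equation. -/
noncomputable def solB (ρ : ℝ) : Fin 3 → ℝ :=
  ![-((1 - ρ ^ 2) * (1 + 4 * ρ + ρ ^ 2) / (2 * (1 + ρ + ρ ^ 2) ^ 2)),
    (1 - ρ) * (2 + ρ) / (1 + ρ + ρ ^ 2)
      - (1 - ρ ^ 2) * (1 + 4 * ρ + ρ ^ 2) / (2 * (1 + ρ + ρ ^ 2) ^ 2),
    (1 - ρ) * (1 + 2 * ρ) / (1 + ρ + ρ ^ 2)
      - (1 - ρ ^ 2) * (1 + 4 * ρ + ρ ^ 2) / (2 * (1 + ρ + ρ ^ 2) ^ 2)]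

/-- `I − (P_B − Π)` is invertible, the mean parameter `πṖ_B1` of game
`B` vanishes, and its variance parameter equals `(3ρ/(1+ρ+ρ²))²`. -/
theorem varianceB (ρ : ℝ) (hρ : 0 < ρ) :
    IsUnit (1 - (PB ρ - PiMat ρ)) ∧
    piB ρ ⬝ᵥ (PBdot ρ *ᵥ (fun _ => 1)) = 0 ∧
    piB ρ ⬝ᵥ (PBddot ρ *ᵥ (fun _ => 1))
      + 2 * (piB ρ ⬝ᵥ ((PBdot ρ * ((1 - (PB ρ - PiMat ρ))⁻¹ - PiMat ρ) * PBdot ρ)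
          *ᵥ (fun _ => 1)))
      = (3 * ρ / (1 + ρ + ρ ^ 2)) ^ 2 := by
  have h1 : (1 + ρ) ≠ 0 := by positivity
  have h2 : (1 + ρ ^ 2) ≠ 0 := by positivity
  have h3 : (1 + ρ + ρ ^ 2) ≠ 0 := by positivity
  have eP : ∀ i j, PiMat ρ i j = piB ρ j := fun _ _ => rfl
  have eD : ∀ i j, PBdot ρ i j = PB ρ i j * W i j := fun _ _ => rfl
  have eDD : ∀ i j, PBddot ρ i j = PB ρ i j * W i j * W i j := fun _ _ => rfl
  have hdet : (1 - (PB ρ - PiMat ρ)).det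
      = 2 * (1 + ρ + ρ ^ 2) ^ 2 / ((1 + ρ) ^ 2 * (1 + ρ ^ 2)) := by
    simp only [Matrix.det_fin_three, Matrix.sub_apply, eP]
    simp [PB, piB]
    field_simp
    ring
  have hu : IsUnit (1 - (PB ρ - PiMat ρ)).det := by
    rw [hdet, isUnit_iff_ne_zero]; positivity
  have hx : (1 - (PB ρ - PiMat ρ)) *ᵥ (solB ρ) = PBdot ρ *ᵥ (fun _ => 1) := by
    ext i
    fin_cases i <;>
      simp only [Matrix.mulVec, dotProduct, Fin.sum_univ_three, Matrix.sub_apply, eP, eD, Matrix.one_apply] <;>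
      simp [PB, piB, W, solB, Fin.ext_iff] <;>
      field_simp <;> ring
  have hz : (1 - (PB ρ - PiMat ρ))⁻¹ *ᵥ (PBdot ρ *ᵥ (fun _ => 1)) = solB ρ := by
    rw [← hx, Matrix.mulVec_mulVec, Matrix.nonsing_inv_mul _ hu, Matrix.one_mulVec]
  have hm : piB ρ ⬝ᵥ (PBdot ρ *ᵥ (fun _ => 1)) = 0 := by
    simp only [Matrix.mulVec, dotProduct, Fin.sum_univ_three, eD]
    simp [PB, piB, W]
    field_simp
    ring
  have hP : PiMat ρ *ᵥ (PBdot ρ *ᵥ (fun _ => 1)) = 0 := by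
    ext i
    exact hm
  refine ⟨(Matrix.isUnit_iff_isUnit_det _).2 hu, hm, ?_⟩
  rw [← Matrix.mulVec_mulVec, ← Matrix.mulVec_mulVec, Matrix.sub_mulVec, hz, hP, sub_zero]
  simp only [Matrix.mulVec, dotProduct, Fin.sum_univ_three, eD, eDD]
  simp [PB, piB, W, solB]
  field_simp
  ring
end

section
/- Fix ρ > 0, an integer N ≥ 2, and γ ∈ [0,1]. Let P := γ·N⁻¹(2P_A + (N−2)I) + (1−γ)·N⁻¹(P_B + (N−1)I) and Ṗ := γ·2N⁻¹(P_A∘W) + (1−γ)·N⁻¹(P_B∘W). Then for every stationary distribution π of P, N·πṖ1 = 3γ(1−γ)(1−ρ)³(1+ρ) / [2(1+ρ+ρ²)² + γ(5+10ρ+6ρ²+10ρ³+5ρ⁴) + 2γ²(1+ρ+ρ²)²]; in particular, the value of N·πṖ1 does not depend on N. -/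
open Matrix

/-- The transition matrix, for one of the `N` players, of the mixture
`γ A' + (1−γ) B`: `P := γ·N⁻¹(2P_A + (N−2)I) + (1−γ)·N⁻¹(P_B + (N−1)I)`. -/
noncomputable def Pmix (ρ γ : ℝ) (N : ℕ) : Matrix (Fin 3) (Fin 3) ℝ :=
  γ • ((N : ℝ)⁻¹ • ((2 : ℝ) • PA + ((N : ℝ) - 2) • (1 : Matrix (Fin 3) (Fin 3) ℝ)))
    + (1 - γ) • ((N : ℝ)⁻¹ • (PB ρ + ((N : ℝ) - 1) • (1 : Matrix (Fin 3) (Fin 3) ℝ)))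

/-- The corresponding payoff-weighted matrix
`Ṗ := γ·2N⁻¹(P_A∘W) + (1−γ)·N⁻¹(P_B∘W)`. -/
noncomputable def Pmixdot (ρ γ : ℝ) (N : ℕ) : Matrix (Fin 3) (Fin 3) ℝ :=
  γ • ((2 * (N : ℝ)⁻¹) • Matrix.of fun i j => PA i j * W i j)
    + (1 - γ) • ((N : ℝ)⁻¹ • Matrix.of fun i j => PB ρ i j * W i j)

/-- for every stationary distribution `π` of `Pmix`,
`N·πṖ1` equals the closed-form mean `μ_{(γ,1−γ)}`, independently of `N`. -/
theorem mean_mixture (ρ : ℝ) (hρ : 0 < ρ) (N : ℕ) (hN : 2 ≤ N)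
    (γ : ℝ) (hγ0 : 0 ≤ γ) (hγ1 : γ ≤ 1)
    (π : Fin 3 → ℝ) (hπ0 : ∀ i, 0 ≤ π i) (hπ1 : ∑ i, π i = 1)
    (hπP : ∀ j, ∑ i, π i * Pmix ρ γ N i j = π j) :
    (N : ℝ) * (π ⬝ᵥ (Pmixdot ρ γ N *ᵥ (fun _ => 1)))
      = 3 * γ * (1 - γ) * (1 - ρ) ^ 3 * (1 + ρ) /
        (2 * (1 + ρ + ρ ^ 2) ^ 2 + γ * (5 + 10 * ρ + 6 * ρ ^ 2 + 10 * ρ ^ 3 + 5 * ρ ^ 4)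
          + 2 * γ ^ 2 * (1 + ρ + ρ ^ 2) ^ 2) := by
  have hN' : (N : ℝ) ≠ 0 := by
    have : 0 < N := by omega
    positivity
  have h1 : (1 + ρ) ≠ 0 := by positivity
  have h2 : (1 + ρ ^ 2) ≠ 0 := by positivity
  have hD : (2 * (1 + ρ + ρ ^ 2) ^ 2 + γ * (5 + 10 * ρ + 6 * ρ ^ 2 + 10 * ρ ^ 3 + 5 * ρ ^ 4)
          + 2 * γ ^ 2 * (1 + ρ + ρ ^ 2) ^ 2) ≠ 0 := by positivity
  have e1 := hπP 0
  have e2 := hπP 1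
  simp [Fin.sum_univ_three, Pmix, PA, PB, Matrix.one_apply] at e1 e2 hπ1
  have hz : π 2 = 1 - π 0 - π 1 := by linarith
  have f1 : π 1 * (γ + ρ) + π 2 * (1 + γ * ρ) = (1 + γ) * (1 + ρ) * π 0 := by
    field_simp at e1
    linear_combination e1
  have f2 : π 0 * (γ + ρ ^ 2) * (1 + ρ) + π 2 * (γ + ρ) * (1 + ρ ^ 2)
      = (1 + γ) * (1 + ρ) * (1 + ρ ^ 2) * π 1 := by
    field_simp at e2
    linear_combination e2
  rw [hz] at f1 f2
  have hx : (2 * (1 + ρ + ρ ^ 2) ^ 2 + γ * (5 + 10 * ρ + 6 * ρ ^ 2 + 10 * ρ ^ 3 + 5 * ρ ^ 4)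
          + 2 * γ ^ 2 * (1 + ρ + ρ ^ 2) ^ 2) * π 0 = (1 + ρ ^ 2) *
      ((1 + γ * ρ) * ((1 + γ) * (1 + ρ) + γ + ρ) - (1 - γ) * (1 - ρ) * (γ + ρ)) := by
    linear_combination (-((1 + γ) * (1 + ρ) + γ + ρ) * (1 + ρ ^ 2)) * f1
      + (1 - γ) * (1 - ρ) * f2
  have hmu : (N : ℝ) * (π ⬝ᵥ (Pmixdot ρ γ N *ᵥ (fun _ => 1)))
      = (1 - γ) * (π 0 * ((ρ ^ 2 - 1) / (1 + ρ ^ 2)) + (1 - π 0) * ((1 - ρ) / (1 + ρ))) := by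
    simp [Fin.sum_univ_three, dotProduct, mulVec, Pmixdot, PA, PB, W]
    rw [hz]
    field_simp
    ring
  rw [hmu, eq_div_iff hD]
  have hx' := eq_div_of_mul_eq hD ((mul_comm _ _).trans hx)
  rw [hx']
  field_simp
  ring
end

section
/- Fix integers r, s ≥ 1 and ρ > 0. Then lim_{N→∞} μ_{[r,s]}^{(N)} = 3rs(1−ρ)³(1+ρ) / [9r²(1+ρ)²(1+ρ²) + 9rs(1+ρ)²(1+ρ²) + 2s²(1+ρ+ρ²)²], where the limit is over integers N → ∞; moreover this limit equals 3γ(1−γ)(1−ρ)³(1+ρ) / [2(1+ρ+ρ²)² + γ(5+10ρ+6ρ²+10ρ³+5ρ⁴) + 2γ²(1+ρ+ρ²)²] with γ := r/(r+s). -/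
theorem powLim (c : ℝ) (s : ℕ) :
    Filter.Tendsto (fun N : ℕ => (N : ℝ) * (1 - (1 - c / (N : ℝ)) ^ s)) Filter.atTop
      (nhds (s * c)) := by
  have hy : Filter.Tendsto (fun N : ℕ => 1 - c / (N : ℝ)) Filter.atTop (nhds 1) := by
    simpa using (tendsto_const_div_atTop_nhds_zero_nat c).const_sub 1
  induction s with
  | zero => simp
  | succ k ih =>
    have h := (ih.mul hy).add_const c
    have e : (k : ℝ) * c * 1 + c = ((k + 1 : ℕ) : ℝ) * c := by push_cast; ring
    rw [e] at h
    refine h.congr' ?_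
    filter_upwards [Filter.eventually_gt_atTop 0] with N hN
    have : (N : ℝ) ≠ 0 := by positivity
    rw [pow_succ]
    generalize (1 - c / (N : ℝ)) ^ k = z
    field_simp
    ring

theorem muRS_rw (N r s : ℕ) (hN : 0 < N) (ρ A P Q x : ℝ) (hx : x = 1 / (N : ℝ))
    (hA : A = (N : ℝ) * (1 - (1 - 3 / (N : ℝ)) ^ r))
    (hP : P = (N : ℝ) * (1 - (1 - (1 - e1c ρ) / (N : ℝ)) ^ s))
    (hQ : Q = (N : ℝ) * (1 - (1 - (1 - e2c ρ) / (N : ℝ)) ^ s)) :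
    muRS N r s ρ =
      (A * ((2 * P * Q + A * (P + Q) - 2 * A * P * Q * x) * (1 - ρ) * (1 + ρ) * Sq ρ
        + A / 3 * (P - Q) * (5 * (1 + ρ) ^ 2 * (1 + ρ ^ 2) - 4 * ρ ^ 2)) * (1 - ρ) ^ 2) /
      (4 * ((r : ℝ) + (s : ℝ)) * (A + P - A * P * x) * (A + Q - A * Q * x)
        * (1 + ρ + ρ ^ 2) ^ 2 * Sq ρ) := by
  have hN' : (N : ℝ) ≠ 0 := by positivity
  have hx0 : x ≠ 0 := by rw [hx]; positivity
  have hNx : (N : ℝ) = 1 / x := by rw [hx]; simp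
  have a1 : aR N r = A * x / 3 := by
    unfold aR; rw [hA, hx]; field_simp
  have a2 : e1 N ρ ^ s = 1 - P * x := by
    unfold e1; rw [hP, hx]; generalize (1 - (1 - e1c ρ) / (N : ℝ)) ^ s = z; field_simp; ring
  have a3 : e2 N ρ ^ s = 1 - Q * x := by
    unfold e2; rw [hQ, hx]; generalize (1 - (1 - e2c ρ) / (N : ℝ)) ^ s = z; field_simp; ring
  unfold muRS Ers Drs
  rw [a1, a2, a3, hNx]
  have hx2 : x ^ 2 ≠ 0 := pow_ne_zero 2 hx0
  rw [← mul_div_mul_left _ (4 * ((r : ℝ) + (s : ℝ)) * (A + P - A * P * x) * (A + Q - A * Q * x)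
        * (1 + ρ + ρ ^ 2) ^ 2 * Sq ρ) hx2]
  congr 1
  · field_simp
    ring
  · ring

open Filter in
/-- `lim_{N→∞} μ_{[r,s]}^{(N)}` exists and equals the random-mixture
mean with `γ = r/(r+s)`. -/
theorem muRS_limit (r s : ℕ) (hr : 1 ≤ r) (hs : 1 ≤ s) (ρ : ℝ) (hρ : 0 < ρ) :
    Tendsto (fun N : ℕ => muRS N r s ρ) atTop
      (nhds (3 * r * s * (1 - ρ) ^ 3 * (1 + ρ) /
        (9 * r ^ 2 * (1 + ρ) ^ 2 * (1 + ρ ^ 2) + 9 * r * s * (1 + ρ) ^ 2 * (1 + ρ ^ 2)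
          + 2 * s ^ 2 * (1 + ρ + ρ ^ 2) ^ 2))) ∧
    (3 * (r : ℝ) * s * (1 - ρ) ^ 3 * (1 + ρ) /
        (9 * r ^ 2 * (1 + ρ) ^ 2 * (1 + ρ ^ 2) + 9 * r * s * (1 + ρ) ^ 2 * (1 + ρ ^ 2)
          + 2 * s ^ 2 * (1 + ρ + ρ ^ 2) ^ 2)
      = 3 * ((r : ℝ) / (r + s)) * (1 - (r : ℝ) / (r + s)) * (1 - ρ) ^ 3 * (1 + ρ) /
        (2 * (1 + ρ + ρ ^ 2) ^ 2
          + ((r : ℝ) / (r + s)) * (5 + 10 * ρ + 6 * ρ ^ 2 + 10 * ρ ^ 3 + 5 * ρ ^ 4)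
          + 2 * ((r : ℝ) / (r + s)) ^ 2 * (1 + ρ + ρ ^ 2) ^ 2)) := by
  have hr' : (0 : ℝ) < r := by exact_mod_cast hr
  have hs' : (0 : ℝ) < s := by exact_mod_cast hs
  constructor
  · have hx : Tendsto (fun N : ℕ => 1 / (N : ℝ)) atTop (nhds 0) :=
      tendsto_const_div_atTop_nhds_zero_nat 1
    have hA := powLim 3 r
    have hP := powLim (1 - e1c ρ) s
    have hQ := powLim (1 - e2c ρ) s
    have hSpos : 0 < Sq ρ := Real.sqrt_pos.mpr (by positivity)
    have hS2 : Sq ρ ^ 2 = (1 + ρ ^ 2) * (1 + 4 * ρ + ρ ^ 2) := Real.sq_sqrt (by positivity)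
    obtain ⟨u, hu⟩ : ∃ u, u = 1 - e1c ρ := ⟨_, rfl⟩
    obtain ⟨v, hv⟩ : ∃ v, v = 1 - e2c ρ := ⟨_, rfl⟩
    have hsum : u + v = 3 := by rw [hu, hv]; unfold e1c e2c; ring
    have hdiff : u - v = -((1 - ρ) * Sq ρ / ((1 + ρ) * (1 + ρ ^ 2))) := by
      rw [hu, hv]; unfold e1c e2c; field_simp; ring
    have hprod : u * v = 2 * (1 + ρ + ρ ^ 2) ^ 2 / ((1 + ρ) ^ 2 * (1 + ρ ^ 2)) := by
      have : u * v = ((u + v) ^ 2 - (u - v) ^ 2) / 4 := by ring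
      rw [this, hsum, hdiff, neg_sq, div_pow, mul_pow, hS2]
      field_simp
      ring
    have hprodpos : 0 < u * v := by rw [hprod]; positivity
    have hden : (r * 3 + s * u) * (r * 3 + s * v)
        = (9 * r ^ 2 * (1 + ρ) ^ 2 * (1 + ρ ^ 2) + 9 * r * s * (1 + ρ) ^ 2 * (1 + ρ ^ 2)
          + 2 * s ^ 2 * (1 + ρ + ρ ^ 2) ^ 2) / ((1 + ρ) ^ 2 * (1 + ρ ^ 2)) := by
      have : (r * 3 + s * u) * (r * 3 + s * v)
        = 9 * r ^ 2 + 3 * r * s * (u + v) + s ^ 2 * (u * v) := by ring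
      rw [this, hsum, hprod]
      apply (eq_div_iff (by positivity)).mpr
      field_simp
      ring
    rw [← hu] at hP
    rw [← hv] at hQ
    have hnum := ((hA.mul (((((((hP.const_mul 2).mul hQ).add (hA.mul (hP.add hQ))).sub
      ((((hA.const_mul 2).mul hP).mul hQ).mul hx)).mul_const (1 - ρ)).mul_const
        (1 + ρ)).mul_const (Sq ρ) |>.add (((hA.div_const 3).mul (hP.sub hQ)).mul_const
        (5 * (1 + ρ) ^ 2 * (1 + ρ ^ 2) - 4 * ρ ^ 2)))).mul_const ((1 - ρ) ^ 2))
    have hd := (((((hA.add hP).sub ((hA.mul hP).mul hx)).const_mul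
      (4 * ((r : ℝ) + (s : ℝ)))).mul ((hA.add hQ).sub ((hA.mul hQ).mul hx))).mul_const
        ((1 + ρ + ρ ^ 2) ^ 2)).mul_const (Sq ρ)
    have hD : 4 * ((r : ℝ) + (s : ℝ)) * (r * 3 + s * u - r * 3 * (s * u) * 0)
        * (r * 3 + s * v - r * 3 * (s * v) * 0) * (1 + ρ + ρ ^ 2) ^ 2 * Sq ρ
        = 4 * ((r : ℝ) + (s : ℝ)) * ((9 * r ^ 2 * (1 + ρ) ^ 2 * (1 + ρ ^ 2)
          + 9 * r * s * (1 + ρ) ^ 2 * (1 + ρ ^ 2)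
          + 2 * s ^ 2 * (1 + ρ + ρ ^ 2) ^ 2) / ((1 + ρ) ^ 2 * (1 + ρ ^ 2)))
          * (1 + ρ + ρ ^ 2) ^ 2 * Sq ρ := by
      rw [← hden]; ring
    rw [hD] at hd
    have hq := hnum.div hd (by positivity)
    have hlim : ∀ a b : ℝ, a = b → ∀ f : ℕ → ℝ, Tendsto f atTop (nhds a) →
        Tendsto f atTop (nhds b) := fun a b h f hf => h ▸ hf
    refine (hlim _ _ ?_ _ hq).congr' ?_
    · have e1 : 2 * (s * u) * (s * v) + (r : ℝ) * 3 * (s * u + s * v)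
          - 2 * (r * 3) * (s * u) * (s * v) * 0
          = 2 * s ^ 2 * (u * v) + 3 * r * s * (u + v) := by ring
      have e2 : (s : ℝ) * u - s * v = s * (u - v) := by ring
      rw [e1, e2, hsum, hdiff, hprod]
      field_simp
      ring
    · filter_upwards [eventually_gt_atTop 0] with N hN
      exact (muRS_rw N r s hN ρ _ _ _ _ rfl rfl (by rw [hu]) (by rw [hv])).symm
  · rw [div_eq_div_iff (by positivity) (by positivity)]
    field_simp
    ring
end

section
/- Fix ρ > 0 and let π be any stationary distribution of the 3×3 row-stochastic matrix (2/3)P_A + (1/3)P_B. Then (3/2)·π[(2/3)(P_A∘W) + (1/3)(P_B∘W)]1 = 3(1−ρ)³(1+ρ) / (2(10+20ρ+21ρ²+20ρ³+10ρ⁴)); that is, three halves of the mean profit per turn of the one-player random mixture (2/3)A + (1/3)B equals the mean profit per turn μ_{(1/2,1/2)} of the equally weighted N-player mixed game. -/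
open Matrix

/-- three halves of the mean profit per turn of the one-player random
mixture `(2/3)A + (1/3)B` equals
`μ_{(1/2,1/2)} = 3(1−ρ)³(1+ρ)/(2(10+20ρ+21ρ²+20ρ³+10ρ⁴))`. -/
theorem coincidence (ρ : ℝ) (hρ : 0 < ρ)
    (π : Fin 3 → ℝ) (hπ0 : ∀ i, 0 ≤ π i) (hπ1 : ∑ i, π i = 1)
    (hπP : ∀ j, ∑ i, π i * ((2 / 3 : ℝ) • PA + (1 / 3 : ℝ) • PB ρ) i j = π j) :
    (3 / 2) * (π ⬝ᵥ
        (((2 / 3 : ℝ) • (Matrix.of fun i j => PA i j * W i j)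
          + (1 / 3 : ℝ) • (Matrix.of fun i j => PB ρ i j * W i j)) *ᵥ (fun _ => 1)))
      = 3 * (1 - ρ) ^ 3 * (1 + ρ) /
        (2 * (10 + 20 * ρ + 21 * ρ ^ 2 + 20 * ρ ^ 3 + 10 * ρ ^ 4)) := by
  have e0 := hπP 0
  have e1 := hπP 1
  simp [Fin.sum_univ_three, PA, PB] at hπ1 e0 e1
  simp [dotProduct, Matrix.mulVec, Fin.sum_univ_three, PA, PB, W]
  generalize π 0 = a at *
  generalize π 1 = b at *
  generalize π 2 = c at *
  obtain rfl : c = 1 - a - b := by linarith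
  have h1 : (1 + ρ) ≠ 0 := by positivity
  have h2 : (1 + ρ ^ 2) ≠ 0 := by positivity
  have hQ : (10 + 20 * ρ + 21 * ρ ^ 2 + 20 * ρ ^ 3 + 10 * ρ ^ 4) ≠ 0 := by positivity
  have key : ∃ T P : ℝ, T = (2 + ρ) / (3 * (1 + ρ)) ∧ P = (1 + 2 * ρ ^ 2) / (3 * (1 + ρ ^ 2)) :=
    ⟨_, _, rfl, rfl⟩
  obtain ⟨T, P, hT, hP⟩ := key
  have hT' : (1 + ρ)⁻¹ = 3 * T - 1 := by rw [hT]; field_simp; ring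
  have hP' : ρ ^ 2 / (1 + ρ ^ 2) = 3 * P - 1 := by rw [hP]; field_simp; ring
  rw [hT'] at e0
  rw [hT', hP'] at e1
  have ha : a * ((1 + T) * (2 - T) - (1 - 2 * T) * (P + T - 1)) = 1 - T + T ^ 2 := by
    linear_combination (-(2 - T)) * e0 - (1 - 2 * T) * e1
  have ha' : a = (7 + 13 * ρ + 7 * ρ ^ 2) * (1 + ρ ^ 2) /
      (2 * (10 + 20 * ρ + 21 * ρ ^ 2 + 20 * ρ ^ 3 + 10 * ρ ^ 4)) := by
    rw [hT, hP] at ha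
    field_simp at ha
    rw [eq_div_iff (by positivity)]
    linear_combination ha
  have hg : (3 / 2) * (a * (2 * P - 1) + (1 - a) * (2 * T - 1)) = 3 * (1 - ρ) ^ 3 * (1 + ρ) /
        (2 * (10 + 20 * ρ + 21 * ρ ^ 2 + 20 * ρ ^ 3 + 10 * ρ ^ 4)) := by
    rw [ha', hT, hP]
    field_simp
    ring
  rw [← hg, hT', hP']
  ring
end

section
/- With the assumptions of the context, and with the distribution of X₀ arbitrary, lim_{n→∞} n⁻¹ Cov(S_n^[1], S_n^[2]) = πP^[1,2]1 − (πP^[1]1)(πP^[2]1) + πP^[1](Z − Π)P^[2]1 + πP^[2](Z − Π)P^[1]1. -/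
open Matrix MeasureTheory Filter

set_option linter.unusedSectionVars false

namespace CovAux

def Good {S : Type*} [MeasurableSpace S] (F : (ℕ → S) → ℝ) : Prop :=
  Measurable F ∧ ∃ C, ∀ ω, |F ω| ≤ C

section
variable {S : Type*} [Fintype S] [MeasurableSpace S] [MeasurableSingletonClass S]

theorem Good.add {F G : (ℕ → S) → ℝ} (hF : Good F) (hG : Good G) :
    Good (fun ω => F ω + G ω) := by
  obtain ⟨hF, C, hC⟩ := hF
  obtain ⟨hG, D, hD⟩ := hG
  exact ⟨hF.add hG, C + D, fun ω => (abs_add_le _ _).trans (add_le_add (hC ω) (hD ω))⟩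

theorem Good.sub {F G : (ℕ → S) → ℝ} (hF : Good F) (hG : Good G) :
    Good (fun ω => F ω - G ω) := by
  obtain ⟨hF, C, hC⟩ := hF
  obtain ⟨hG, D, hD⟩ := hG
  exact ⟨hF.sub hG, C + D, fun ω => (abs_sub _ _).trans (add_le_add (hC ω) (hD ω))⟩

theorem Good.mul {F G : (ℕ → S) → ℝ} (hF : Good F) (hG : Good G) :
    Good (fun ω => F ω * G ω) := by
  obtain ⟨hF, C, hC⟩ := hF
  obtain ⟨hG, D, hD⟩ := hG
  refine ⟨hF.mul hG, C * D, fun ω => ?_⟩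
  rw [abs_mul]
  exact mul_le_mul (hC ω) (hD ω) (abs_nonneg _) ((abs_nonneg _).trans (hC ω))

theorem good_const (c : ℝ) : Good (fun _ : ℕ → S => c) :=
  ⟨measurable_const, |c|, fun _ => le_rfl⟩

theorem good_one (f : S → ℝ) (m : ℕ) : Good (fun ω : ℕ → S => f (ω m)) := by
  refine ⟨(measurable_of_finite f).comp (measurable_pi_apply m), ∑ i, |f i|, fun ω => ?_⟩
  exact Finset.single_le_sum (f := fun i => |f i|) (fun i _ => abs_nonneg _) (Finset.mem_univ (ω m))

theorem good_two (f : S → S → ℝ) (m n : ℕ) : Good (fun ω : ℕ → S => f (ω m) (ω n)) := by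
  have hm : Measurable (fun ω : ℕ → S => (ω m, ω n)) :=
    (measurable_pi_apply m).prodMk (measurable_pi_apply n)
  refine ⟨(measurable_of_finite (fun p : S × S => f p.1 p.2)).comp hm, ∑ p : S × S, |f p.1 p.2|, fun ω => ?_⟩
  exact Finset.single_le_sum (f := fun p : S × S => |f p.1 p.2|) (fun i _ => abs_nonneg _)
    (Finset.mem_univ (ω m, ω n))

theorem good_sum (f : S → S → ℝ) (n : ℕ) :
    Good (fun ω : ℕ → S => ∑ m ∈ Finset.range n, f (ω m) (ω (m + 1))) := by
  induction n with
  | zero => simpa using good_const 0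
  | succ n ih =>
    simp only [Finset.sum_range_succ]
    exact ih.add (good_two f n (n + 1))

theorem Good.int {F : (ℕ → S) → ℝ} (hF : Good F) (μ : Measure (ℕ → S)) [IsProbabilityMeasure μ] :
    Integrable F μ := by
  obtain ⟨hF, C, hC⟩ := hF
  exact Integrable.of_bound hF.aestronglyMeasurable C (ae_of_all _ hC)

theorem integral_fin {T : Type*} [Fintype T] [MeasurableSpace T] [MeasurableSingletonClass T]
    (μ : Measure (ℕ → S)) [IsProbabilityMeasure μ] (X : (ℕ → S) → T) (hX : Measurable X)
    (G : T → ℝ) : ∫ ω, G (X ω) ∂μ = ∑ t, μ.real (X ⁻¹' {t}) * G t := by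
  have := Measure.isProbabilityMeasure_map (μ := μ) hX.aemeasurable
  rw [← integral_map (f := G) hX.aemeasurable (measurable_of_finite G).aestronglyMeasurable,
    integral_fintype Integrable.of_finite]
  refine Finset.sum_congr rfl fun t _ => ?_
  rw [map_measureReal_apply hX (measurableSet_singleton t), smul_eq_mul]

def MarkovP (P : Matrix S S ℝ) (μ : Measure (ℕ → S)) : Prop :=
  ∀ (n : ℕ) (f : ℕ → S) (y : S),
      μ {ω | (∀ i ≤ n, ω i = f i) ∧ ω (n + 1) = y}
        = μ {ω | ∀ i ≤ n, ω i = f i} * ENNReal.ofReal (P (f n) y)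

theorem step (P : Matrix S S ℝ) (hP0 : ∀ i j, 0 ≤ P i j)
    (μ : Measure (ℕ → S)) [IsProbabilityMeasure μ] (hM : MarkovP P μ) (n : ℕ)
    (Φ : (Fin (n + 1) → S) → ℝ) (f : S → S → ℝ) :
    ∫ ω, Φ (fun i => ω i) * f (ω n) (ω (n + 1)) ∂μ
      = ∫ ω, Φ (fun i => ω i) * ∑ j, P (ω n) j * f (ω n) j ∂μ := by
  have hX1 : Measurable (fun ω : ℕ → S => (fun i : Fin (n + 1) => ω i)) :=
    measurable_pi_lambda _ fun i => measurable_pi_apply _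
  have h1 := integral_fin μ (fun ω => ((fun i : Fin (n + 1) => ω i), ω (n + 1)))
    (hX1.prodMk (measurable_pi_apply (n + 1)))
    (fun p => Φ p.1 * f (p.1 (Fin.last n)) p.2)
  have h2 := integral_fin μ (fun ω => (fun i : Fin (n + 1) => ω i)) hX1
    (fun p => Φ p * ∑ j, P (p (Fin.last n)) j * f (p (Fin.last n)) j)
  simp only [Fin.val_last] at h1 h2
  rw [h1, h2, Fintype.sum_prod_type]
  refine Finset.sum_congr rfl fun p _ => ?_
  have key : ∀ y, μ.real ((fun ω : ℕ → S => ((fun i : Fin (n + 1) => ω i), ω (n + 1))) ⁻¹' {(p, y)})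
      = μ.real ((fun ω : ℕ → S => (fun i : Fin (n + 1) => ω i)) ⁻¹' {p}) * P (p (Fin.last n)) y := by
    intro y
    let g : ℕ → S := fun i => if h : i < n + 1 then p ⟨i, h⟩ else p 0
    have hg : ∀ ω : ℕ → S, (fun i : Fin (n + 1) => ω i) = p ↔ ∀ i ≤ n, ω i = g i := by
      intro ω
      constructor
      · intro h i hi
        have hi' : i < n + 1 := by omega
        simp only [g, dif_pos hi', ← h]
      · intro h
        funext i
        have := h i (by omega)
        simpa only [g, dif_pos i.2] using this
    have e1 : (fun ω : ℕ → S => ((fun i : Fin (n + 1) => ω i), ω (n + 1))) ⁻¹' {(p, y)}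
        = {ω | (∀ i ≤ n, ω i = g i) ∧ ω (n + 1) = y} := by
      ext ω
      simp only [Set.mem_preimage, Set.mem_singleton_iff, Prod.mk.injEq, hg, Set.mem_ofPred_eq]
    have e2 : (fun ω : ℕ → S => (fun i : Fin (n + 1) => ω i)) ⁻¹' {p}
        = {ω | ∀ i ≤ n, ω i = g i} := by
      ext ω
      simp only [Set.mem_preimage, Set.mem_singleton_iff, hg, Set.mem_ofPred_eq]
    have hgn : g n = p (Fin.last n) := by simp [g, Fin.last]
    rw [e1, e2, measureReal_def, measureReal_def, hM n g y, ENNReal.toReal_mul,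
      ENNReal.toReal_ofReal (hP0 _ _), hgn]
  simp only [key, Finset.mul_sum]
  refine Finset.sum_congr rfl fun y _ => ?_
  ring

theorem step_one (P : Matrix S S ℝ) (hP0 : ∀ i j, 0 ≤ P i j)
    (μ : Measure (ℕ → S)) [IsProbabilityMeasure μ] (hM : MarkovP P μ) (n : ℕ)
    (f : S → S → ℝ) :
    ∫ ω, f (ω n) (ω (n + 1)) ∂μ = ∫ ω, ∑ j, P (ω n) j * f (ω n) j ∂μ := by
  simpa using step P hP0 μ hM n (fun _ => 1) f

theorem step_mart (P : Matrix S S ℝ) (hP0 : ∀ i j, 0 ≤ P i j)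
    (μ : Measure (ℕ → S)) [IsProbabilityMeasure μ] (hM : MarkovP P μ) (n : ℕ)
    (f g : S → S → ℝ) (hf : ∀ i, ∑ j, P i j * f i j = 0) :
    ∫ ω, (∑ m ∈ Finset.range n, g (ω m) (ω (m + 1))) * f (ω n) (ω (n + 1)) ∂μ = 0 := by
  have := step P hP0 μ hM n (fun p => ∑ m : Fin n, g (p m.castSucc) (p m.succ)) f
  simp only [hf, mul_zero, integral_zero, Fin.val_castSucc, Fin.val_succ] at this
  simp only [Finset.sum_range]
  exact this

theorem mart_mean (P : Matrix S S ℝ) (hP0 : ∀ i j, 0 ≤ P i j)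
    (μ : Measure (ℕ → S)) [IsProbabilityMeasure μ] (hM : MarkovP P μ) (n : ℕ)
    (f : S → S → ℝ) (hf : ∀ i, ∑ j, P i j * f i j = 0) :
    ∫ ω, ∑ m ∈ Finset.range n, f (ω m) (ω (m + 1)) ∂μ = 0 := by
  rw [integral_finsetSum _ fun m _ => (good_two f m (m + 1)).int μ]
  refine Finset.sum_eq_zero fun m _ => ?_
  rw [step_one P hP0 μ hM m f]
  simp [hf]

theorem mart_prod (P : Matrix S S ℝ) (hP0 : ∀ i j, 0 ≤ P i j)
    (μ : Measure (ℕ → S)) [IsProbabilityMeasure μ] (hM : MarkovP P μ) (n : ℕ)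
    (f g : S → S → ℝ) (hf : ∀ i, ∑ j, P i j * f i j = 0) (hg : ∀ i, ∑ j, P i j * g i j = 0) :
    ∫ ω, (∑ m ∈ Finset.range n, f (ω m) (ω (m + 1)))
      * (∑ m ∈ Finset.range n, g (ω m) (ω (m + 1))) ∂μ
      = ∑ m ∈ Finset.range n, ∫ ω, (fun i => ∑ j, P i j * (f i j * g i j)) (ω m) ∂μ := by
  induction n with
  | zero => simp
  | succ n ih =>
    rw [Finset.sum_range_succ, ← ih, ← step_one P hP0 μ hM n (fun i j => f i j * g i j)]
    have e : ∀ ω : ℕ → S, (∑ m ∈ Finset.range (n + 1), f (ω m) (ω (m + 1)))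
      * (∑ m ∈ Finset.range (n + 1), g (ω m) (ω (m + 1)))
      = (((∑ m ∈ Finset.range n, f (ω m) (ω (m + 1)))
      * (∑ m ∈ Finset.range n, g (ω m) (ω (m + 1)))
      + f (ω n) (ω (n + 1)) * g (ω n) (ω (n + 1)))
      + (∑ m ∈ Finset.range n, f (ω m) (ω (m + 1))) * g (ω n) (ω (n + 1)))
      + (∑ m ∈ Finset.range n, g (ω m) (ω (m + 1))) * f (ω n) (ω (n + 1)) := by
      intro ω
      rw [Finset.sum_range_succ, Finset.sum_range_succ]
      ring
    simp only [e]
    have g1 := (good_sum f n).mul (good_sum g n)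
    have g2 := (good_two f n (n + 1)).mul (good_two g n (n + 1))
    have g3 := (good_sum f n).mul (good_two g n (n + 1))
    have g4 := (good_sum g n).mul (good_two f n (n + 1))
    rw [integral_add (((g1.add g2).add g3).int μ) (g4.int μ),
      integral_add ((g1.add g2).int μ) (g3.int μ), integral_add (g1.int μ) (g2.int μ),
      step_mart P hP0 μ hM n g f hg, step_mart P hP0 μ hM n f g hf]
    ring

theorem bdd_int (μ : Measure (ℕ → S)) [IsProbabilityMeasure μ] (F : (ℕ → S) → ℝ) (C : ℝ)
    (h : ∀ ω, |F ω| ≤ C) : |∫ ω, F ω ∂μ| ≤ C := by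
  have := norm_integral_le_of_norm_le_const (μ := μ) (f := F) (C := C) (ae_of_all _ h)
  simpa using this

theorem bdd_div (u : ℕ → ℝ) (C : ℝ) (h : ∀ n, |u n| ≤ C) :
    Tendsto (fun n : ℕ => u n / (n : ℝ)) atTop (nhds 0) := by
  refine squeeze_zero_norm (a := fun n : ℕ => C / (n : ℝ)) (fun n => ?_)
    (tendsto_const_div_atTop_nhds_zero_nat C)
  rw [norm_div, Real.norm_eq_abs, Real.norm_natCast]
  exact div_le_div_of_nonneg_right (h n) (Nat.cast_nonneg n)

theorem cesaro (P : Matrix S S ℝ) (hP0 : ∀ i j, 0 ≤ P i j)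
    (μ : Measure (ℕ → S)) [IsProbabilityMeasure μ] (hM : MarkovP P μ)
    (f h : S → ℝ) (a : ℝ) (hh : ∀ i, f i = a + h i - ∑ j, P i j * h j) :
    Tendsto (fun n : ℕ => (∑ m ∈ Finset.range n, ∫ ω, f (ω m) ∂μ) / (n : ℝ)) atTop (nhds a) := by
  have hs : ∀ n : ℕ, ∑ m ∈ Finset.range n, ∫ ω, f (ω m) ∂μ
      = n * a + ((∫ ω, h (ω 0) ∂μ) - ∫ ω, h (ω n) ∂μ) := by
    intro n
    induction n with
    | zero => simp
    | succ n ih =>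
      rw [Finset.sum_range_succ, ih]
      have : ∫ ω, f (ω n) ∂μ = a + ∫ ω, h (ω n) ∂μ - ∫ ω, h (ω (n + 1)) ∂μ := by
        rw [step_one P hP0 μ hM n (fun _ j => h j)]
        simp only [hh]
        rw [integral_sub (((good_const a).add (good_one h n)).int μ)
          ((good_one (fun i => ∑ j, P i j * h j) n).int μ),
          integral_add ((good_const a).int μ) ((good_one h n).int μ)]
        simp
      rw [this]
      push_cast
      ring
  have hb : ∀ n : ℕ, |(∫ ω, h (ω 0) ∂μ) - ∫ ω, h (ω n) ∂μ| ≤ (∑ i, |h i|) + ∑ i, |h i| := by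
    intro n
    have hb' : ∀ m : ℕ, |∫ ω, h (ω m) ∂μ| ≤ ∑ i, |h i| := fun m => bdd_int μ _ _ fun ω =>
      Finset.single_le_sum (f := fun i => |h i|) (fun i _ => abs_nonneg _) (Finset.mem_univ (ω m))
    exact (abs_sub _ _).trans (add_le_add (hb' 0) (hb' n))
  have := (bdd_div _ _ hb).const_add a
  rw [add_zero] at this
  refine this.congr' ?_
  filter_upwards [eventually_gt_atTop 0] with n hn
  have : (n : ℝ) ≠ 0 := by positivity
  rw [hs]
  field_simp

theorem cross (μ : Measure (ℕ → S)) [IsProbabilityMeasure μ]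
    (M B : ℕ → (ℕ → S) → ℝ) (hM : ∀ n, Good (M n)) (hB : ∀ n, Good (B n)) (C c : ℝ)
    (hC : ∀ n ω, |B n ω| ≤ C)
    (hc : Tendsto (fun n : ℕ => (∫ ω, M n ω * M n ω ∂μ) / (n : ℝ)) atTop (nhds c)) :
    Tendsto (fun n : ℕ => (∫ ω, M n ω * B n ω ∂μ) / (n : ℝ)) atTop (nhds 0) := by
  have hs : Tendsto (fun n : ℕ => (Real.sqrt n)⁻¹) atTop (nhds 0) :=
    tendsto_inv_atTop_zero.comp (Real.tendsto_sqrt_atTop.comp tendsto_natCast_atTop_atTop)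
  have hlim : Tendsto (fun n : ℕ => ((∫ ω, M n ω * M n ω ∂μ) / (n : ℝ) + C ^ 2) * (Real.sqrt n)⁻¹)
      atTop (nhds 0) := by
    simpa using (hc.add_const (C ^ 2)).mul hs
  refine squeeze_zero_norm' ?_ hlim
  filter_upwards [eventually_gt_atTop 0] with n hn
  have hn' : (0 : ℝ) < n := by exact_mod_cast hn
  set s := Real.sqrt n with hsdef
  have hs0 : 0 < s := Real.sqrt_pos.2 hn'
  have hss : s * s = n := Real.mul_self_sqrt hn'.le
  have hpt : ∀ ω, |M n ω * B n ω| ≤ s⁻¹ * (M n ω * M n ω) + s * C ^ 2 := by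
    intro ω
    have hb := hC n ω
    have hb2 : (B n ω) ^ 2 ≤ C ^ 2 := by
      rw [← sq_abs (B n ω)]
      exact pow_le_pow_left₀ (abs_nonneg _) hb 2
    have e : s⁻¹ * (M n ω * M n ω) = s * (s⁻¹ * M n ω) ^ 2 := by field_simp
    have e2 : M n ω = s * (s⁻¹ * M n ω) := by field_simp
    rw [e]
    generalize s⁻¹ * M n ω = x at e2
    rw [e2, mul_assoc, abs_mul, abs_of_pos hs0, ← mul_add]
    refine mul_le_mul_of_nonneg_left ?_ hs0.le
    rw [abs_le]
    constructor <;> nlinarith [sq_nonneg (x - B n ω), sq_nonneg (x + B n ω)]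
  have hint : |∫ ω, M n ω * B n ω ∂μ| ≤ s⁻¹ * (∫ ω, M n ω * M n ω ∂μ) + s * C ^ 2 := by
    refine abs_integral_le_integral_abs.trans ?_
    have gg := (good_const s⁻¹).mul ((hM n).mul (hM n))
    have : ∫ ω, (s⁻¹ * (M n ω * M n ω) + s * C ^ 2) ∂μ
        = s⁻¹ * (∫ ω, M n ω * M n ω ∂μ) + s * C ^ 2 := by
      rw [integral_add (gg.int μ) ((good_const _).int μ), integral_const_mul]
      simp
    rw [← this]
    exact integral_mono (((hM n).mul (hB n)).int μ).abs ((gg.add (good_const _)).int μ) hpt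
  rw [norm_div, Real.norm_eq_abs, Real.norm_natCast, div_le_iff₀ hn']
  refine hint.trans (le_of_eq ?_)
  rw [← hss]
  field_simp

end

section alg
variable {S : Type*} [Fintype S] [DecidableEq S]

theorem poisson (P : Matrix S S ℝ) (hProw : ∀ i, ∑ j, P i j = 1)
    (π : S → ℝ) (hπ1 : ∑ i, π i = 1)
    (hπP : ∀ j, ∑ i, π i * P i j = π j)
    (Pim : Matrix S S ℝ) (hPim : ∀ i j, Pim i j = π j)
    (Z : Matrix S S ℝ) (hZ : Z * (1 - (P - Pim)) = 1 ∧ (1 - (P - Pim)) * Z = 1)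
    (g h : S → ℝ) (hh : h = (Z - Pim) *ᵥ g) :
    (∀ i, g i = π ⬝ᵥ g + h i - ∑ j, P i j * h j) ∧ ∑ i, π i * h i = 0 := by
  have hPimg : ∀ v : S → ℝ, Pim *ᵥ v = fun _ => π ⬝ᵥ v := by
    intro v
    funext i
    simp [mulVec, dotProduct, hPim]
  have hPiP : Pim * P = Pim := by
    ext i j
    simp [Matrix.mul_apply, hPim, hπP]
  have hPPi : P * Pim = Pim := by
    ext i j
    simp [Matrix.mul_apply, hPim, ← Finset.sum_mul, hProw]
  have hPiPi : Pim * Pim = Pim := by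
    ext i j
    simp [Matrix.mul_apply, hPim, ← Finset.sum_mul, hπ1]
  have hPiA : Pim * (1 - (P - Pim)) = Pim := by
    rw [mul_sub, mul_sub, hPiP, hPiPi]; simp
  have hPiZ : Pim * Z = Pim := by
    conv_lhs => rw [← hPiA]
    rw [mul_assoc, hZ.2, mul_one]
  have h0 : Pim * (Z - Pim) = 0 := by rw [mul_sub, hPiZ, hPiPi, sub_self]
  have h1 : (1 - P) * (Z - Pim) = 1 - Pim := by
    have : (1 - P) * (Z - Pim) = (1 - (P - Pim)) * Z - Pim * Z - Pim + P * Pim := by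
      noncomm_ring
    rw [this, hZ.2, hPiZ, hPPi]
    abel
  constructor
  · intro i
    have := congrFun (congrArg (fun A => A *ᵥ g) h1) i
    simp only [← mulVec_mulVec, ← hh, sub_mulVec, one_mulVec, hPimg, Pi.sub_apply] at this
    have e : (P *ᵥ h) i = ∑ j, P i j * h j := rfl
    rw [e] at this
    linarith
  · by_cases hS : Nonempty S
    · obtain ⟨i⟩ := hS
      have := congrFun (congrArg (fun A => A *ᵥ g) h0) i
      simp only [← mulVec_mulVec, ← hh, hPimg, zero_mulVec] at this
      exact this
    · simp only [not_nonempty_iff] at hS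
      simp

end alg

theorem final_alg {S : Type*} [Fintype S] (P : Matrix S S ℝ) (hProw : ∀ i, ∑ j, P i j = 1)
    (π : S → ℝ) (hπ1 : ∑ i, π i = 1)
    (hπP : ∀ j, ∑ i, π i * P i j = π j) (w1 w2 : S → S → ℝ) (g1 g2 h1 h2 : S → ℝ) (a1 a2 : ℝ)
    (hg1 : ∀ i, g1 i = ∑ j, P i j * w1 i j) (hg2 : ∀ i, g2 i = ∑ j, P i j * w2 i j)
    (ha1 : a1 = ∑ i, π i * g1 i) (ha2 : a2 = ∑ i, π i * g2 i)
    (hh1 : ∀ i, g1 i = a1 + h1 i - ∑ j, P i j * h1 j)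
    (hh2 : ∀ i, g2 i = a2 + h2 i - ∑ j, P i j * h2 j)
    (z1 : ∑ i, π i * h1 i = 0) (z2 : ∑ i, π i * h2 i = 0) :
    ∑ i, π i * ∑ j, P i j * ((w1 i j - a1 + h1 j - h1 i) * (w2 i j - a2 + h2 j - h2 i))
    = ∑ i, π i * (∑ j, P i j * w1 i j * w2 i j) - a1 * a2
      + ∑ i, π i * (∑ j, P i j * w1 i j * h2 j) + ∑ i, π i * (∑ j, P i j * w2 i j * h1 j) := by
  have inner : ∀ i, ∑ j, P i j * ((w1 i j - a1 + h1 j - h1 i) * (w2 i j - a2 + h2 j - h2 i))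
      = (∑ j, P i j * w1 i j * w2 i j) + (∑ j, P i j * w1 i j * h2 j)
        + (∑ j, P i j * w2 i j * h1 j) + (∑ j, P i j * (h1 j * h2 j))
        - (a1 + h1 i) * (a2 + h2 i) := by
    intro i
    have s1 : ∑ j, P i j * h1 j = a1 + h1 i - ∑ j, P i j * w1 i j := by
      have := hh1 i; rw [hg1] at this; linarith
    have s2 : ∑ j, P i j * h2 j = a2 + h2 i - ∑ j, P i j * w2 i j := by
      have := hh2 i; rw [hg2] at this; linarith
    have e : ∑ j, P i j * ((w1 i j - a1 + h1 j - h1 i) * (w2 i j - a2 + h2 j - h2 i))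
      = (∑ j, P i j * w1 i j * w2 i j) + (∑ j, P i j * w1 i j * h2 j)
        + (∑ j, P i j * w2 i j * h1 j) + (∑ j, P i j * (h1 j * h2 j))
        - (a2 + h2 i) * (∑ j, P i j * w1 i j) - (a1 + h1 i) * (∑ j, P i j * w2 i j)
        - (a2 + h2 i) * (∑ j, P i j * h1 j) - (a1 + h1 i) * (∑ j, P i j * h2 j)
        + (a1 + h1 i) * (a2 + h2 i) * ∑ j, P i j := by
      simp only [Finset.mul_sum, ← Finset.sum_add_distrib, ← Finset.sum_sub_distrib]
      refine Finset.sum_congr rfl fun j _ => ?_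
      ring
    rw [e, s1, s2, hProw]
    ring
  have q : ∑ i, π i * ∑ j, P i j * (h1 j * h2 j) = ∑ i, π i * (h1 i * h2 i) := by
    simp only [Finset.mul_sum]
    rw [Finset.sum_comm]
    refine Finset.sum_congr rfl fun j _ => ?_
    rw [← hπP j, Finset.sum_mul]
    refine Finset.sum_congr rfl fun i _ => ?_
    ring
  have q2 : ∑ i, π i * ((a1 + h1 i) * (a2 + h2 i)) = a1 * a2 + ∑ i, π i * (h1 i * h2 i) := by
    have : ∑ i, π i * ((a1 + h1 i) * (a2 + h2 i)) = a1 * a2 * (∑ i, π i) + a1 * (∑ i, π i * h2 i)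
       + a2 * (∑ i, π i * h1 i) + ∑ i, π i * (h1 i * h2 i) := by
      simp only [Finset.mul_sum, ← Finset.sum_add_distrib]
      refine Finset.sum_congr rfl fun j _ => ?_
      ring
    rw [this, z1, z2, hπ1]
    ring
  rw [Finset.sum_congr rfl fun i _ => congrArg (fun x => π i * x) (inner i)]
  have r : ∀ (A B C D E : S → ℝ), ∑ i, π i * (A i + B i + C i + D i - E i)
      = ∑ i, π i * A i + ∑ i, π i * B i + ∑ i, π i * C i + ∑ i, π i * D i - ∑ i, π i * E i := by
    intro A B C D E
    simp only [mul_add, mul_sub, Finset.sum_add_distrib, Finset.sum_sub_distrib]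
  rw [r, q, q2]
  linarith

end CovAux

set_option maxHeartbeats 2000000 in
/-- for an irreducible aperiodic finite Markov chain with transition
matrix `P`, unique stationary distribution `π`, fundamental matrix `Z`, and two payoff
functions `w¹, w²`, the normalized covariance `n⁻¹ Cov(Sₙ¹, Sₙ²)` of the cumulative
payoffs converges to
`πP^[1,2]1 − (πP^[1]1)(πP^[2]1) + πP^[1](Z − Π)P^[2]1 + πP^[2](Z − Π)P^[1]1`,
for an arbitrary initial distribution. -/
theorem covariance_parameter
    {S : Type*} [Fintype S] [DecidableEq S] [Nonempty S]
    [MeasurableSpace S] [MeasurableSingletonClass S]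
    (P : Matrix S S ℝ) (hP0 : ∀ i j, 0 ≤ P i j) (hProw : ∀ i, ∑ j, P i j = 1)
    (hirr : ∀ i j, ∃ n, 1 ≤ n ∧ 0 < (P ^ n) i j)
    (haper : ∀ i, ∀ d : ℕ, (∀ n, 1 ≤ n → 0 < (P ^ n) i i → d ∣ n) → d = 1)
    (π : S → ℝ) (hπ0 : ∀ i, 0 ≤ π i) (hπ1 : ∑ i, π i = 1)
    (hπP : ∀ j, ∑ i, π i * P i j = π j)
    (Pim : Matrix S S ℝ) (hPim : ∀ i j, Pim i j = π j)
    (Z : Matrix S S ℝ) (hZ : Z * (1 - (P - Pim)) = 1 ∧ (1 - (P - Pim)) * Z = 1)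
    (w1 w2 : S → S → ℝ)
    -- the Markov chain: canonical coordinate process under `μ`, with arbitrary
    -- initial distribution and one-step transition matrix `P`
    (μ : Measure (ℕ → S)) [IsProbabilityMeasure μ]
    (hMarkov : ∀ (n : ℕ) (f : ℕ → S) (y : S),
      μ {ω | (∀ i ≤ n, ω i = f i) ∧ ω (n + 1) = y}
        = μ {ω | ∀ i ≤ n, ω i = f i} * ENNReal.ofReal (P (f n) y)) :
    Tendsto (fun n : ℕ =>
        ((∫ ω, (∑ m ∈ Finset.range n, w1 (ω m) (ω (m + 1)))
              * (∑ m ∈ Finset.range n, w2 (ω m) (ω (m + 1))) ∂μ)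
          - (∫ ω, ∑ m ∈ Finset.range n, w1 (ω m) (ω (m + 1)) ∂μ)
            * (∫ ω, ∑ m ∈ Finset.range n, w2 (ω m) (ω (m + 1)) ∂μ)) / (n : ℝ))
      atTop
      (nhds (π ⬝ᵥ ((Matrix.of fun i j => P i j * w1 i j * w2 i j) *ᵥ (fun _ => 1))
        - (π ⬝ᵥ ((Matrix.of fun i j => P i j * w1 i j) *ᵥ (fun _ => 1)))
          * (π ⬝ᵥ ((Matrix.of fun i j => P i j * w2 i j) *ᵥ (fun _ => 1)))
        + π ⬝ᵥ (((Matrix.of fun i j => P i j * w1 i j) * (Z - Pim)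
            * (Matrix.of fun i j => P i j * w2 i j)) *ᵥ (fun _ => 1))
        + π ⬝ᵥ (((Matrix.of fun i j => P i j * w2 i j) * (Z - Pim)
            * (Matrix.of fun i j => P i j * w1 i j)) *ᵥ (fun _ => 1)))) := by
  
  have hM : CovAux.MarkovP P μ := hMarkov
  set g1 : S → ℝ := (Matrix.of fun i j => P i j * w1 i j) *ᵥ (fun _ => 1) with hg1
  set g2 : S → ℝ := (Matrix.of fun i j => P i j * w2 i j) *ᵥ (fun _ => 1) with hg2
  set a1 := π ⬝ᵥ g1 with ha1
  set a2 := π ⬝ᵥ g2 with ha2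
  obtain ⟨h1, hh1⟩ : ∃ h, h = (Z - Pim) *ᵥ g1 := ⟨_, rfl⟩
  obtain ⟨h2, hh2⟩ : ∃ h, h = (Z - Pim) *ᵥ g2 := ⟨_, rfl⟩
  obtain ⟨p1, z1⟩ := CovAux.poisson P hProw π hπ1 hπP Pim hPim Z hZ g1 h1 hh1
  obtain ⟨p2, z2⟩ := CovAux.poisson P hProw π hπ1 hπP Pim hPim Z hZ g2 h2 hh2
  have hg1' : ∀ i, g1 i = ∑ j, P i j * w1 i j := fun i => by simp [hg1, mulVec, dotProduct]
  have hg2' : ∀ i, g2 i = ∑ j, P i j * w2 i j := fun i => by simp [hg2, mulVec, dotProduct]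
  have hfin := CovAux.final_alg P hProw π hπ1 hπP w1 w2 g1 g2 h1 h2 a1 a2 hg1' hg2' rfl rfl
    p1 p2 z1 z2
  set D1 : S → S → ℝ := fun i j => w1 i j - a1 + h1 j - h1 i with hD1
  set D2 : S → S → ℝ := fun i j => w2 i j - a2 + h2 j - h2 i with hD2
  have zero : ∀ (w : S → S → ℝ) (g h : S → ℝ) (a : ℝ), (∀ i, g i = ∑ j, P i j * w i j) →
      (∀ i, g i = a + h i - ∑ j, P i j * h j) →
      ∀ i, ∑ j, P i j * (w i j - a + h j - h i) = 0 := by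
    intro w g h a hg hp i
    have e : ∑ j, P i j * (w i j - a + h j - h i) = (∑ j, P i j * w i j) + (∑ j, P i j * h j)
        - (a + h i) * ∑ j, P i j := by
      simp only [Finset.mul_sum, ← Finset.sum_add_distrib, ← Finset.sum_sub_distrib]
      refine Finset.sum_congr rfl fun j _ => ?_
      ring
    rw [e, hProw, ← hg, hp i]
    ring
  have d1 : ∀ i, ∑ j, P i j * D1 i j = 0 := zero w1 g1 h1 a1 hg1' p1
  have d2 : ∀ i, ∑ j, P i j * D2 i j = 0 := zero w2 g2 h2 a2 hg2' p2
  have prodlim : ∀ f g : S → S → ℝ, (∀ i, ∑ j, P i j * f i j = 0) →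
      (∀ i, ∑ j, P i j * g i j = 0) →
      Tendsto (fun n : ℕ => (∫ ω, (∑ m ∈ Finset.range n, f (ω m) (ω (m + 1)))
        * (∑ m ∈ Finset.range n, g (ω m) (ω (m + 1))) ∂μ) / (n : ℝ)) atTop
        (nhds (∑ i, π i * ∑ j, P i j * (f i j * g i j))) := by
    intro f g hf hg
    simp only [CovAux.mart_prod P hP0 μ hM _ f g hf hg]
    exact CovAux.cesaro P hP0 μ hM _ _ _
      (CovAux.poisson P hProw π hπ1 hπP Pim hPim Z hZ
        (fun i => ∑ j, P i j * (f i j * g i j)) _ rfl).1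
  set M1 : ℕ → (ℕ → S) → ℝ := fun n ω => ∑ m ∈ Finset.range n, D1 (ω m) (ω (m + 1)) with hM1
  set M2 : ℕ → (ℕ → S) → ℝ := fun n ω => ∑ m ∈ Finset.range n, D2 (ω m) (ω (m + 1)) with hM2
  set B1 : ℕ → (ℕ → S) → ℝ := fun n ω => h1 (ω 0) - h1 (ω n) with hB1
  set B2 : ℕ → (ℕ → S) → ℝ := fun n ω => h2 (ω 0) - h2 (ω n) with hB2
  have gM1 : ∀ n, CovAux.Good (M1 n) := fun n => CovAux.good_sum D1 n
  have gM2 : ∀ n, CovAux.Good (M2 n) := fun n => CovAux.good_sum D2 n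
  have gB1 : ∀ n, CovAux.Good (B1 n) := fun n => (CovAux.good_one h1 0).sub (CovAux.good_one h1 n)
  have gB2 : ∀ n, CovAux.Good (B2 n) := fun n => (CovAux.good_one h2 0).sub (CovAux.good_one h2 n)
  have bd : ∀ (h : S → ℝ) (i j : S), |h i - h j| ≤ (∑ i, |h i|) + ∑ i, |h i| := by
    intro h i j
    have hb' : ∀ m : S, |h m| ≤ ∑ i, |h i| := fun m =>
      Finset.single_le_sum (f := fun i => |h i|) (fun i _ => abs_nonneg _) (Finset.mem_univ m)
    exact (abs_sub _ _).trans (add_le_add (hb' i) (hb' j))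
  have bB1 : ∀ n ω, |B1 n ω| ≤ (∑ i, |h1 i|) + ∑ i, |h1 i| := fun n ω => bd h1 _ _
  have bB2 : ∀ n ω, |B2 n ω| ≤ (∑ i, |h2 i|) + ∑ i, |h2 i| := fun n ω => bd h2 _ _
  have L12 := prodlim D1 D2 d1 d2
  have X1 := CovAux.cross μ M1 B2 gM1 gB2 _ _ bB2 (prodlim D1 D1 d1 d1)
  have X2 := CovAux.cross μ M2 B1 gM2 gB1 _ _ bB1 (prodlim D2 D2 d2 d2)
  have Y1 := CovAux.bdd_div (fun n => (∫ ω, B1 n ω * B2 n ω ∂μ)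
      - (∫ ω, B1 n ω ∂μ) * (∫ ω, B2 n ω ∂μ))
      (((∑ i, |h1 i|) + ∑ i, |h1 i|) * ((∑ i, |h2 i|) + ∑ i, |h2 i|)
        + ((∑ i, |h1 i|) + ∑ i, |h1 i|) * ((∑ i, |h2 i|) + ∑ i, |h2 i|)) (fun n => by
    refine (abs_sub _ _).trans (add_le_add (CovAux.bdd_int μ _
      (((∑ i, |h1 i|) + ∑ i, |h1 i|) * ((∑ i, |h2 i|) + ∑ i, |h2 i|)) fun ω => ?_) ?_)
    · rw [abs_mul]
      exact mul_le_mul (bB1 n ω) (bB2 n ω) (abs_nonneg _) ((abs_nonneg _).trans (bB1 n ω))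
    · rw [abs_mul]
      exact mul_le_mul (CovAux.bdd_int μ _ _ (bB1 n)) (CovAux.bdd_int μ _ _ (bB2 n))
        (abs_nonneg _) ((abs_nonneg _).trans (CovAux.bdd_int μ _ _ (bB1 n))))
  have tot := ((L12.add X1).add X2).add Y1
  rw [add_zero, add_zero, add_zero] at tot
  have target : (∑ i, π i * ∑ j, P i j * (D1 i j * D2 i j))
      = (π ⬝ᵥ ((Matrix.of fun i j => P i j * w1 i j * w2 i j) *ᵥ (fun _ => 1))
        - a1 * a2
        + π ⬝ᵥ (((Matrix.of fun i j => P i j * w1 i j) * (Z - Pim)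
            * (Matrix.of fun i j => P i j * w2 i j)) *ᵥ (fun _ => 1))
        + π ⬝ᵥ (((Matrix.of fun i j => P i j * w2 i j) * (Z - Pim)
            * (Matrix.of fun i j => P i j * w1 i j)) *ᵥ (fun _ => 1))) := by
    rw [← mulVec_mulVec, ← mulVec_mulVec, ← mulVec_mulVec, ← mulVec_mulVec, ← hg1, ← hg2,
      ← hh1, ← hh2]
    refine hfin.trans ?_
    simp [mulVec, dotProduct]
  rw [← target]
  refine tot.congr fun n => ?_
  have dec : ∀ (w : S → S → ℝ) (h : S → ℝ) (a : ℝ) (ω : ℕ → S),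
      ∑ m ∈ Finset.range n, w (ω m) (ω (m + 1))
      = n * a + ((∑ m ∈ Finset.range n,
          (w (ω m) (ω (m + 1)) - a + h (ω (m + 1)) - h (ω m))) + (h (ω 0) - h (ω n))) := by
    intro w h a ω
    have t := Finset.sum_range_sub (fun m => h (ω m)) n
    have : ∑ m ∈ Finset.range n, (w (ω m) (ω (m + 1)) - a + h (ω (m + 1)) - h (ω m))
        = ∑ m ∈ Finset.range n, w (ω m) (ω (m + 1)) - n * a
          + ∑ m ∈ Finset.range n, (h (ω (m + 1)) - h (ω m)) := by
      simp only [Finset.sum_add_distrib, Finset.sum_sub_distrib, Finset.sum_const,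
        Finset.card_range, nsmul_eq_mul]
      ring
    rw [this, t]
    ring
  have dec1 : ∀ ω : ℕ → S, ∑ m ∈ Finset.range n, w1 (ω m) (ω (m + 1))
      = n * a1 + (M1 n ω + B1 n ω) := dec w1 h1 a1
  have dec2 : ∀ ω : ℕ → S, ∑ m ∈ Finset.range n, w2 (ω m) (ω (m + 1))
      = n * a2 + (M2 n ω + B2 n ω) := dec w2 h2 a2
  have m1 : ∫ ω, M1 n ω ∂μ = 0 := CovAux.mart_mean P hP0 μ hM n D1 d1
  have m2 : ∫ ω, M2 n ω ∂μ = 0 := CovAux.mart_mean P hP0 μ hM n D2 d2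
  have i1 : ∫ ω, (n * a1 + (M1 n ω + B1 n ω)) ∂μ = n * a1 + ∫ ω, B1 n ω ∂μ := by
    rw [integral_add ((CovAux.good_const _).int μ) (((gM1 n).add (gB1 n)).int μ),
      integral_add ((gM1 n).int μ) ((gB1 n).int μ), m1]
    simp
  have i2 : ∫ ω, (n * a2 + (M2 n ω + B2 n ω)) ∂μ = n * a2 + ∫ ω, B2 n ω ∂μ := by
    rw [integral_add ((CovAux.good_const _).int μ) (((gM2 n).add (gB2 n)).int μ),
      integral_add ((gM2 n).int μ) ((gB2 n).int μ), m2]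
    simp
  have i12 : ∫ ω, (n * a1 + (M1 n ω + B1 n ω)) * (n * a2 + (M2 n ω + B2 n ω)) ∂μ
      = n * a1 * (n * a2 + ∫ ω, B2 n ω ∂μ) + n * a2 * (∫ ω, B1 n ω ∂μ)
        + (∫ ω, M1 n ω * M2 n ω ∂μ) + (∫ ω, M1 n ω * B2 n ω ∂μ) + (∫ ω, M2 n ω * B1 n ω ∂μ)
        + ∫ ω, B1 n ω * B2 n ω ∂μ := by
    have e : ∀ ω, (n * a1 + (M1 n ω + B1 n ω)) * (n * a2 + (M2 n ω + B2 n ω))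
        = n * a1 * (n * a2 + (M2 n ω + B2 n ω)) + n * a2 * (M1 n ω + B1 n ω)
        + M1 n ω * M2 n ω + M1 n ω * B2 n ω + M2 n ω * B1 n ω + B1 n ω * B2 n ω := by
      intro ω
      ring
    simp only [e]
    have k1 := (CovAux.good_const (n * a1)).mul
      ((CovAux.good_const (n * a2)).add ((gM2 n).add (gB2 n)))
    have k2 := (CovAux.good_const (n * a2)).mul ((gM1 n).add (gB1 n))
    have k3 := (gM1 n).mul (gM2 n)
    have k4 := (gM1 n).mul (gB2 n)
    have k5 := (gM2 n).mul (gB1 n)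
    have k6 := (gB1 n).mul (gB2 n)
    rw [integral_add (((((k1.add k2).add k3).add k4).add k5).int μ) (k6.int μ),
      integral_add ((((k1.add k2).add k3).add k4).int μ) (k5.int μ),
      integral_add (((k1.add k2).add k3).int μ) (k4.int μ),
      integral_add ((k1.add k2).int μ) (k3.int μ),
      integral_add (k1.int μ) (k2.int μ), integral_const_mul, integral_const_mul, i2,
      integral_add ((gM1 n).int μ) ((gB1 n).int μ), m1, zero_add]
  simp only [dec1, dec2]
  rw [i1, i2, i12]
  ring
end

section
/- Fix γ ∈ (0,1) and let (X_n)_{n≥0} be the Markov chain on Σ_N with one-step transition matrix P := γP_{A'}^{(N)} + (1−γ)P_B^{(N)} and arbitrary initial distribution. Then almost surely S_n/n → 3γ(1−γ)(1−ρ)³(1+ρ) / [2(1+ρ+ρ²)² + γ(5+10ρ+6ρ²+10ρ³+5ρ⁴) + 2γ²(1+ρ+ρ²)²] as n → ∞; in particular the limit does not depend on N, and it is positive when 0 < ρ < 1. -/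
open MeasureTheory Filter

lemma aux_orth {E : Type*} [Fintype E] [MeasurableSpace E] [MeasurableSingletonClass E]
    (P D : E → E → ℝ) (hP0 : ∀ x y, 0 ≤ P x y) (hD : ∀ x, ∑ y, P x y * D x y = 0)
    (μ : Measure (ℕ → E)) [IsProbabilityMeasure μ]
    (hM : ∀ (n : ℕ) (f : ℕ → E) (y : E),
      μ {ω | (∀ i ≤ n, ω i = f i) ∧ ω (n + 1) = y}
        = μ {ω | ∀ i ≤ n, ω i = f i} * ENNReal.ofReal (P (f n) y))
    (n : ℕ) (F : (ℕ → E) → ℝ) (hF : ∀ ω ω', (∀ i ≤ n, ω i = ω' i) → F ω = F ω') :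
    ∫ ω, F ω * D (ω n) (ω (n + 1)) ∂μ = 0 := by
  let π : (ℕ → E) → (Fin (n + 1) → E) × E := fun ω => (fun i => ω i, ω (n + 1))
  let e : (Fin (n + 1) → E) → (ℕ → E) := fun a i => a ⟨min i n, by omega⟩
  have hπ : Measurable π := by
    refine Measurable.prodMk ?_ (measurable_pi_apply _)
    exact measurable_pi_lambda _ fun i => measurable_pi_apply _
  let g : (Fin (n + 1) → E) × E → ℝ := fun p => F (e p.1) * D (e p.1 n) p.2
  have h1 : ∀ ω, F ω * D (ω n) (ω (n + 1)) = g (π ω) := by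
    intro ω
    have : F ω = F (e (π ω).1) := by
      apply hF
      intro i hi
      simp [π, e, hi]
    simp only [g]
    rw [← this]
    simp [π, e]
  simp_rw [h1]
  have : IsProbabilityMeasure (μ.map π) := Measure.isProbabilityMeasure_map hπ.aemeasurable
  rw [← integral_map (f := g) hπ.aemeasurable (Measurable.of_discrete.aestronglyMeasurable),
    integral_fintype .of_finite, Fintype.sum_prod_type]
  refine Finset.sum_eq_zero fun a _ => ?_
  have h2 : ∀ y, (μ.map π).real {(a, y)} = μ.real {ω | ∀ i ≤ n, ω i = e a i} * P (e a n) y := by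
    intro y
    rw [measureReal_def, Measure.map_apply hπ (measurableSet_singleton _)]
    have : π ⁻¹' {(a, y)} = {ω | (∀ i ≤ n, ω i = e a i) ∧ ω (n + 1) = y} := by
      ext ω
      simp only [Set.mem_preimage, Set.mem_singleton_iff, Prod.mk.injEq, Set.mem_ofPred_eq, π]
      refine and_congr_left fun _ => ?_
      constructor
      · rintro h i hi
        simp [e, hi, ← h]
      · intro h
        ext i
        have hi : (i : ℕ) ≤ n := by omega
        rw [h i hi]
        simp [e, hi]
    rw [this, hM, ENNReal.toReal_mul, ENNReal.toReal_ofReal (hP0 _ _), measureReal_def]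
  simp_rw [h2, smul_eq_mul, g]
  have : ∀ y, μ.real {ω | ∀ i ≤ n, ω i = e a i} * P (e a n) y * (F (e a) * D (e a n) y)
      = μ.real {ω | ∀ i ≤ n, ω i = e a i} * F (e a) * (P (e a n) y * D (e a n) y) := by
    intro y; ring
  simp_rw [this, ← Finset.mul_sum, hD, mul_zero]

lemma aux_slln {E : Type*} [Fintype E] [MeasurableSpace E] [MeasurableSingletonClass E]
    (P D : E → E → ℝ) (hP0 : ∀ x y, 0 ≤ P x y) (hD : ∀ x, ∑ y, P x y * D x y = 0)
    (μ : Measure (ℕ → E)) [IsProbabilityMeasure μ]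
    (hM : ∀ (n : ℕ) (f : ℕ → E) (y : E),
      μ {ω | (∀ i ≤ n, ω i = f i) ∧ ω (n + 1) = y}
        = μ {ω | ∀ i ≤ n, ω i = f i} * ENNReal.ofReal (P (f n) y)) :
    ∀ᵐ ω ∂μ, Tendsto
      (fun n : ℕ => (∑ m ∈ Finset.range n, D (ω m) (ω (m + 1))) / (n : ℝ)) atTop (nhds 0) := by
  obtain ⟨C, hC0, hC⟩ : ∃ C : ℝ, 0 ≤ C ∧ ∀ x y, |D x y| ≤ C := by
    refine ⟨∑ x, ∑ y, |D x y|, by positivity, fun x y => ?_⟩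
    calc |D x y| ≤ ∑ y, |D x y| :=
          Finset.single_le_sum (f := fun y => |D x y|) (fun _ _ => abs_nonneg _) (Finset.mem_univ y)
      _ ≤ _ := Finset.single_le_sum (f := fun x => ∑ y, |D x y|)
          (fun _ _ => by positivity) (Finset.mem_univ x)
  set M : ℕ → (ℕ → E) → ℝ := fun n ω => ∑ m ∈ Finset.range n, D (ω m) (ω (m + 1)) with hMdef
  have mD : ∀ m, Measurable fun ω : ℕ → E => D (ω m) (ω (m + 1)) := by
    intro m
    have h1 : Measurable fun p : E × E => D p.1 p.2 := Measurable.of_discrete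
    have h2 : Measurable fun ω : ℕ → E => (ω m, ω (m + 1)) :=
      (measurable_pi_apply m).prodMk (measurable_pi_apply (m + 1))
    exact h1.comp h2
  have mM : ∀ n, Measurable (M n) := fun n => Finset.measurable_sum _ fun m _ => mD m
  have bM : ∀ n ω, |M n ω| ≤ n * C := by
    intro n ω
    refine (Finset.abs_sum_le_sum_abs _ _).trans ?_
    refine (Finset.sum_le_sum fun m _ => hC _ _).trans ?_
    simp
  have iM : ∀ n, Integrable (fun ω => M n ω ^ 2) μ := by
    intro n
    refine Integrable.of_bound ((mM n).pow_const 2).aestronglyMeasurable ((n * C) ^ 2)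
      (ae_of_all _ fun ω => ?_)
    rw [Real.norm_eq_abs, abs_pow]
    exact pow_le_pow_left₀ (abs_nonneg _) (bM n ω) 2
  have iMD : ∀ n, Integrable (fun ω => M n ω * D (ω n) (ω (n + 1))) μ := by
    intro n
    refine Integrable.of_bound ((mM n).mul (mD n)).aestronglyMeasurable ((n * C) * C)
      (ae_of_all _ fun ω => ?_)
    rw [Real.norm_eq_abs, abs_mul]
    exact mul_le_mul (bM n ω) (hC _ _) (abs_nonneg _) (by positivity)
  have iD : ∀ n, Integrable (fun ω : ℕ → E => D (ω n) (ω (n + 1)) ^ 2) μ := by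
    intro n
    refine Integrable.of_bound ((mD n).pow_const 2).aestronglyMeasurable (C ^ 2)
      (ae_of_all _ fun ω => ?_)
    rw [Real.norm_eq_abs, abs_pow]
    exact pow_le_pow_left₀ (abs_nonneg _) (hC _ _) 2
  have eM : ∀ n : ℕ, ∫ ω, M n ω ^ 2 ∂μ ≤ n * C ^ 2 := by
    intro n
    induction n with
    | zero => simp [hMdef]
    | succ n ih =>
      have h : ∀ ω, M (n + 1) ω ^ 2 =
          M n ω ^ 2 + 2 * (M n ω * D (ω n) (ω (n + 1))) + D (ω n) (ω (n + 1)) ^ 2 := by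
        intro ω
        simp only [hMdef, Finset.sum_range_succ]
        ring
      have hz : ∫ ω, M n ω * D (ω n) (ω (n + 1)) ∂μ = 0 := by
        refine aux_orth P D hP0 hD μ hM n (M n) fun ω ω' h => ?_
        refine Finset.sum_congr rfl fun m hm => ?_
        have := Finset.mem_range.1 hm
        rw [h m (by omega), h (m + 1) (by omega)]
      have hd : ∫ ω, D (ω n) (ω (n + 1)) ^ 2 ∂μ ≤ C ^ 2 := by
        calc _ ≤ ∫ ω, C ^ 2 ∂μ := by
              refine integral_mono (iD n) (integrable_const _) fun ω => ?_
              show D (ω n) (ω (n + 1)) ^ 2 ≤ C ^ 2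
              rw [← sq_abs]
              exact pow_le_pow_left₀ (abs_nonneg _) (hC _ _) 2
          _ = _ := by simp
      simp_rw [h]
      rw [integral_add (f := fun ω => M n ω ^ 2 + 2 * (M n ω * D (ω n) (ω (n + 1))))
        ((iM n).add ((iMD n).const_mul 2)) (iD n), integral_add (iM n) ((iMD n).const_mul 2), integral_const_mul, hz]
      push_cast
      linarith
  have key : ∀ᵐ ω ∂μ, Tendsto (fun k : ℕ => M (k ^ 2) ω / ((k ^ 2 : ℕ) : ℝ)) atTop (nhds 0) := by
    have hs : Summable fun k : ℕ => C ^ 2 * (1 / (k : ℝ) ^ 2) :=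
      (Real.summable_one_div_nat_pow.2 (by norm_num)).mul_left _
    have hl : ∫⁻ ω, ∑' k : ℕ, ENNReal.ofReal ((M (k ^ 2) ω / ((k ^ 2 : ℕ) : ℝ)) ^ 2) ∂μ ≠ ⊤ := by
      rw [lintegral_tsum fun k =>
        (((mM (k ^ 2)).div_const _).pow_const 2).ennreal_ofReal.aemeasurable]
      refine ne_top_of_le_ne_top hs.tsum_ofReal_ne_top (ENNReal.tsum_le_tsum fun k => ?_)
      have hi : Integrable (fun ω => (M (k ^ 2) ω / ((k ^ 2 : ℕ) : ℝ)) ^ 2) μ := by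
        simp_rw [div_pow]
        exact (iM _).div_const _
      rw [← ofReal_integral_eq_lintegral_ofReal hi (ae_of_all _ fun ω => sq_nonneg _)]
      apply ENNReal.ofReal_le_ofReal
      simp_rw [div_pow]
      rw [integral_div]
      rcases Nat.eq_zero_or_pos k with rfl | hk
      · simp
      have hk' : (0 : ℝ) < k := by exact_mod_cast hk
      rw [div_le_iff₀ (by positivity)]
      refine (eM _).trans (le_of_eq ?_)
      push_cast
      field_simp
    have hm : Measurable fun ω => ∑' k : ℕ, ENNReal.ofReal ((M (k ^ 2) ω / ((k ^ 2 : ℕ) : ℝ)) ^ 2) :=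
      Measurable.tsum fun k => (((mM (k ^ 2)).div_const _).pow_const 2).ennreal_ofReal
    filter_upwards [ae_lt_top hm hl] with ω hω
    have h1 := ENNReal.tendsto_atTop_zero_of_tsum_ne_top hω.ne
    have h2 := (ENNReal.tendsto_toReal ENNReal.zero_ne_top).comp h1
    have h3 : Tendsto (fun k : ℕ => (M (k ^ 2) ω / ((k ^ 2 : ℕ) : ℝ)) ^ 2) atTop (nhds 0) := by
      refine h2.congr fun k => ?_
      simp only [Function.comp]
      exact ENNReal.toReal_ofReal (sq_nonneg _)
    have h4 := h3.sqrt
    simp only [Real.sqrt_sq_eq_abs, Real.sqrt_zero] at h4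
    exact (tendsto_zero_iff_abs_tendsto_zero _).2 h4
  filter_upwards [key] with ω hω
  have hu := tendsto_div_of_monotone_of_exists_subseq_tendsto_div (fun n => M n ω + n * C) C
    (monotone_nat_of_le_succ fun n => by
      simp only [hMdef, Finset.sum_range_succ]
      push_cast
      have := (abs_le.1 (hC (ω n) (ω (n + 1)))).1
      linarith)
    (fun a ha => by
      refine ⟨fun k => k ^ 2, ?_, ?_, ?_⟩
      · have h1 : Tendsto (fun k : ℕ => (1 + 1 / (k : ℝ)) ^ 2) atTop (nhds ((1 + 0) ^ 2)) :=
          (tendsto_one_div_atTop_nhds_zero_nat.const_add 1).pow 2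
        have h2 := h1.eventually_lt_const (u := a) (by simpa using ha)
        filter_upwards [h2, eventually_gt_atTop 0] with k hk hk0
        have hk' : (0 : ℝ) < k := by exact_mod_cast hk0
        push_cast
        have : ((k : ℝ) + 1) ^ 2 = (1 + 1 / (k : ℝ)) ^ 2 * k ^ 2 := by field_simp
        rw [this]
        gcongr
      · exact tendsto_pow_atTop (by norm_num)
      · have h1 := hω.add_const C
        rw [zero_add] at h1
        refine h1.congr' ?_
        filter_upwards [eventually_gt_atTop 0] with k hk0
        have hk' : (0 : ℝ) < k := by exact_mod_cast hk0
        push_cast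
        field_simp)
  have h1 := hu.sub_const C
  rw [sub_self] at h1
  refine h1.congr' ?_
  filter_upwards [eventually_gt_atTop 0] with k hk0
  have hk' : (0 : ℝ) < k := by exact_mod_cast hk0
  field_simp
  ring

lemma aux_poisson (ρ : ℝ) (hρ : 0 < ρ) (γ : ℝ) (hγ0 : 0 < γ) (hγ1 : γ < 1) :
    ∃ g : ZMod 3 → ℝ, ∀ s : ZMod 3,
      γ * (g (s - 1) + g (s + 1) - 2 * g s) + (1 - γ) *
        ((if s = 0 then ρ ^ 2 / (1 + ρ ^ 2) else 1 / (1 + ρ)) * (1 + (g (s + 1) - g s))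
        + (1 - (if s = 0 then ρ ^ 2 / (1 + ρ ^ 2) else 1 / (1 + ρ))) * (-1 + (g (s - 1) - g s)))
      = 3 * γ * (1 - γ) * (1 - ρ) ^ 3 * (1 + ρ) /
          (2 * (1 + ρ + ρ ^ 2) ^ 2 + γ * (5 + 10 * ρ + 6 * ρ ^ 2 + 10 * ρ ^ 3 + 5 * ρ ^ 4)
            + 2 * γ ^ 2 * (1 + ρ + ρ ^ 2) ^ 2) := by
  obtain ⟨p0, hp0⟩ : ∃ p0, p0 = ρ ^ 2 / (1 + ρ ^ 2) := ⟨_, rfl⟩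
  obtain ⟨p1, hp1⟩ : ∃ p1, p1 = 1 / (1 + ρ) := ⟨_, rfl⟩
  obtain ⟨u0, hu0⟩ : ∃ u0, u0 = γ + (1 - γ) * p0 := ⟨_, rfl⟩
  obtain ⟨d0, hd0⟩ : ∃ d0, d0 = γ + (1 - γ) * (1 - p0) := ⟨_, rfl⟩
  obtain ⟨u, hu⟩ : ∃ u, u = γ + (1 - γ) * p1 := ⟨_, rfl⟩
  obtain ⟨d, hd⟩ : ∃ d, d = γ + (1 - γ) * (1 - p1) := ⟨_, rfl⟩
  have q0 : 1 - p0 = 1 / (1 + ρ ^ 2) := by rw [hp0]; field_simp; ring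
  have q1 : 1 - p1 = ρ / (1 + ρ) := by rw [hp1]; field_simp; ring
  have g1 : 0 < 1 - γ := by linarith
  have u0p : 0 < u0 := by rw [hu0, hp0]; positivity
  have up : 0 < u := by rw [hu, hp1]; positivity
  have d0p : 0 < d0 := by rw [hd0, q0]; positivity
  have dp : 0 < d := by rw [hd, q1]; positivity
  have hS : 0 < (u * u + d0 * u + d0 * d) + (u0 * u + d * u + d * d0) + (u * u0 + d * u0 + d * d) := by
    positivity
  obtain ⟨S, hSd⟩ : ∃ S, S = (u * u + d0 * u + d0 * d) + (u0 * u + d * u + d * d0)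
    + (u * u0 + d * u0 + d * d) := ⟨_, rfl⟩
  rw [← hSd] at hS
  have hc : 3 * γ * (1 - γ) * (1 - ρ) ^ 3 * (1 + ρ) /
          (2 * (1 + ρ + ρ ^ 2) ^ 2 + γ * (5 + 10 * ρ + 6 * ρ ^ 2 + 10 * ρ ^ 3 + 5 * ρ ^ 4)
            + 2 * γ ^ 2 * (1 + ρ + ρ ^ 2) ^ 2) = 3 * (u0 * u * u - d0 * d * d) / S := by
    rw [div_eq_div_iff (by positivity) hS.ne', hSd, hu0, hd0, hu, hd, q0, q1, hp0, hp1]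
    field_simp
    ring
  rw [hc, ← hp0, ← hp1]
  obtain ⟨a, ha⟩ : ∃ a, a = 3 * (u * u + d0 * u + d0 * d) / S - 1 := ⟨_, rfl⟩
  obtain ⟨b, hb⟩ : ∃ b, b = a + 3 * (u0 * u + d * u + d * d0) / S - 1 := ⟨_, rfl⟩
  have e0 : u0 * (1 + a) + d0 * (-1 + b) = 3 * (u0 * u * u - d0 * d * d) / S := by
    rw [hb, ha]; field_simp; rw [hSd]; ring
  have e1 : u * (1 + b - a) + d * (-1 - a) = 3 * (u0 * u * u - d0 * d * d) / S := by
    rw [hb, ha]; field_simp; ring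
  have e2 : u * (1 - b) + d * (-1 + a - b) = 3 * (u0 * u * u - d0 * d * d) / S := by
    rw [hb, ha]; field_simp; rw [hSd]; ring
  refine ⟨![0, a, b], fun s => ?_⟩
  have h1 : (1 : ZMod 3) - 1 = 0 := rfl
  fin_cases s
  · change γ * (b + a - 2 * 0) + (1 - γ) * (p0 * (1 + (a - 0)) + (1 - p0) * (-1 + (b - 0))) = _
    rw [← e0, hu0, hd0]; ring
  · change γ * (0 + b - 2 * a) + (1 - γ) * (p1 * (1 + (b - a)) + (1 - p1) * (-1 + (0 - a))) = _
    rw [← e1, hu, hd]; ring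
  · change γ * (a + 0 - 2 * b) + (1 - γ) * (p1 * (1 + (0 - b)) + (1 - p1) * (-1 + (a - b))) = _
    rw [← e2, hu, hd]; ring

lemma aux_h1 {N : ℕ} (g : ZMod 3 → ℝ) (x : Fin N → ZMod 3) (i : Fin N) (v : ZMod 3) :
    ∑ k, g (Function.update x i v k) - ∑ k, g (x k) = g v - g (x i) := by
  rw [← Finset.sum_sub_distrib, Finset.sum_eq_single i]
  · simp
  · intro k _ hk
    simp [hk]
  · simp

lemma aux_z1 (a : ZMod 3) : a + 1 ≠ a := by revert a; decide
lemma aux_z2 (a : ZMod 3) : a - 1 ≠ a := by revert a; decide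
lemma aux_z3 (a : ZMod 3) : a + 1 ≠ a - 1 := by revert a; decide

lemma aux_sumB {N : ℕ} (p : ZMod 3 → ℝ) 
    (PB : Matrix (Fin N → ZMod 3) (Fin N → ZMod 3) ℝ)
    (hPBwin : ∀ (x y : Fin N → ZMod 3) (i : Fin N), y i = x i + 1 →
      (∀ j, j ≠ i → y j = x j) → PB x y = p (x i) / N)
    (hPBlose : ∀ (x y : Fin N → ZMod 3) (i : Fin N), y i = x i - 1 →
      (∀ j, j ≠ i → y j = x j) → PB x y = (1 - p (x i)) / N)
    (hPBzero : ∀ x y : Fin N → ZMod 3,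
      (¬ ∃ i, (y i = x i + 1 ∨ y i = x i - 1) ∧ ∀ j, j ≠ i → y j = x j) → PB x y = 0)
    (x : Fin N → ZMod 3) (F : (Fin N → ZMod 3) → ℝ) :
    ∑ y, PB x y * F y = ∑ i, (p (x i) / N * F (Function.update x i (x i + 1)) +
      (1 - p (x i)) / N * F (Function.update x i (x i - 1))) := by
  let e : Fin N × Bool → (Fin N → ZMod 3) := fun q =>
    Function.update x q.1 (if q.2 then x q.1 + 1 else x q.1 - 1)
  have hv : ∀ (b : Bool) (a : ZMod 3), (if b then a + 1 else a - 1) ≠ a := by decide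
  have he : Function.Injective e := by
    rintro ⟨i, b⟩ ⟨j, b'⟩ h
    have hij : i = j := by
      by_contra hne
      have := congrFun h i
      simp only [e, Function.update_self, Function.update_of_ne hne] at this
      exact hv _ _ this
    subst hij
    have := congrFun h i
    simp only [e, Function.update_self] at this
    have hb : ∀ (b b' : Bool) (a : ZMod 3), (if b then a + 1 else a - 1) =
      (if b' then a + 1 else a - 1) → b = b' := by decide
    rw [hb _ _ _ this]
  have hs := Fintype.sum_of_injective e he (fun q => PB x (e q) * F (e q))
    (fun y => PB x y * F y) (by
      intro y hy
      show PB x y * F y = 0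
      rw [hPBzero x y, zero_mul]
      rintro ⟨i, h | h, h'⟩
      · refine hy ⟨(i, true), ?_⟩
        ext k
        by_cases hk : k = i
        · subst hk; simp [e, h]
        · simp [e, hk, h' k hk]
      · refine hy ⟨(i, false), ?_⟩
        ext k
        by_cases hk : k = i
        · subst hk; simp [e, h]
        · simp [e, hk, h' k hk]) (fun _ => rfl)
  rw [← hs, Fintype.sum_prod_type]
  refine Finset.sum_congr rfl fun i _ => ?_
  rw [Fintype.sum_bool]
  have h1 : PB x (e (i, true)) = p (x i) / N :=
    hPBwin x _ i (by simp [e]) (fun j hj => by simp [e, hj])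
  have h2 : PB x (e (i, false)) = (1 - p (x i)) / N :=
    hPBlose x _ i (by simp [e]) (fun j hj => by simp [e, hj])
  rw [h1, h2]
  simp [e]

def auxA {N : ℕ} (x : Fin N → ZMod 3) (i j : Fin N) : Fin N → ZMod 3 :=
  Function.update (Function.update x i (x i - 1)) j (x j + 1)

lemma auxA_i {N : ℕ} (x : Fin N → ZMod 3) {i j : Fin N} (h : i ≠ j) :
    auxA x i j i = x i - 1 := by simp [auxA, h]
lemma auxA_j {N : ℕ} (x : Fin N → ZMod 3) (i j : Fin N) :
    auxA x i j j = x j + 1 := by simp [auxA]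
lemma auxA_k {N : ℕ} (x : Fin N → ZMod 3) {i j k : Fin N} (h : k ≠ i) (h' : k ≠ j) :
    auxA x i j k = x k := by simp [auxA, h, h']

lemma aux_sumA {N : ℕ} 
    (PA : Matrix (Fin N → ZMod 3) (Fin N → ZMod 3) ℝ)
    (hPAone : ∀ (x y : Fin N → ZMod 3) (i j : Fin N), i ≠ j →
      y i = x i - 1 → y j = x j + 1 → (∀ k, k ≠ i → k ≠ j → y k = x k) →
      PA x y = 1 / ((N : ℝ) * ((N : ℝ) - 1)))
    (hPAzero : ∀ x y : Fin N → ZMod 3,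
      (¬ ∃ i j, i ≠ j ∧ y i = x i - 1 ∧ y j = x j + 1 ∧ ∀ k, k ≠ i → k ≠ j → y k = x k) →
      PA x y = 0)
    (x : Fin N → ZMod 3) (F : (Fin N → ZMod 3) → ℝ) :
    ∑ y, PA x y * F y = ∑ q ∈ (Finset.univ : Finset (Fin N)).offDiag,
      1 / ((N : ℝ) * ((N : ℝ) - 1)) * F (auxA x q.1 q.2) := by
  symm
  refine Finset.sum_of_injOn (fun q => auxA x q.1 q.2) ?_ (by simp [Set.MapsTo]) ?_ ?_
  · rintro ⟨i, j⟩ hq ⟨i', j'⟩ hq' h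
    simp only [Finset.coe_offDiag, Set.mem_offDiag] at hq hq'
    have hij : i ≠ j := hq.2.2
    have hij' : i' ≠ j' := hq'.2.2
    simp only at h
    have hi : i = i' := by
      by_contra hne
      have h1 := congrFun h i
      rw [auxA_i x hij] at h1
      by_cases h2 : i = j'
      · subst h2
        rw [auxA_j] at h1
        exact aux_z3 _ h1.symm
      · rw [auxA_k x hne h2] at h1
        exact aux_z2 _ h1
    have hj : j = j' := by
      by_contra hne
      have h1 := congrFun h j
      rw [auxA_j] at h1
      rw [auxA_k x (by rw [← hi]; exact hij.symm) hne] at h1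
      exact aux_z1 _ h1
    rw [hi, hj]
  · intro y _ hy
    rw [hPAzero x y, zero_mul]
    rintro ⟨i, j, hij, h1, h2, h3⟩
    refine hy ⟨(i, j), by simpa using hij, ?_⟩
    ext k
    by_cases hi : k = i
    · subst hi; simp only; rw [auxA_i x hij, h1]
    by_cases hj : k = j
    · subst hj; simp only; rw [auxA_j, h2]
    simp only; rw [auxA_k x hi hj, h3 k hi hj]
  · rintro ⟨i, j⟩ hq
    have hij : i ≠ j := by simpa using hq
    rw [hPAone x _ i j hij (auxA_i x hij) (auxA_j x i j) (fun k h h' => auxA_k x h h')]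

lemma aux_off {N : ℕ} (a b : Fin N → ℝ) :
    ∑ q ∈ (Finset.univ : Finset (Fin N)).offDiag, (a q.1 + b q.2)
      = ((N : ℝ) - 1) * ∑ i, (a i + b i) := by
  have h : ∑ q ∈ (Finset.univ : Finset (Fin N)).diag, (a q.1 + b q.2) +
      ∑ q ∈ (Finset.univ : Finset (Fin N)).offDiag, (a q.1 + b q.2) =
      ∑ q ∈ (Finset.univ : Finset (Fin N)) ×ˢ Finset.univ, (a q.1 + b q.2) := by
    rw [← Finset.sum_union (Finset.disjoint_diag_offDiag _), Finset.diag_union_offDiag]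
  rw [Finset.sum_diag, Finset.sum_product] at h
  simp only [Finset.sum_add_distrib, Finset.sum_const, Finset.card_univ, Fintype.card_fin,
    nsmul_eq_mul, ← Finset.mul_sum] at h ⊢
  linarith

/-- strong law of large numbers for the profit of the ensemble of `N`
players playing the random mixture `γ A' + (1−γ) B` of Toral's games: almost surely
`Sₙ/n → 3γ(1−γ)(1−ρ)³(1+ρ)/[2(1+ρ+ρ²)² + γ(5+10ρ+6ρ²+10ρ³+5ρ⁴) + 2γ²(1+ρ+ρ²)²]`,
a limit not depending on `N` and positive for `0 < ρ < 1`. -/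
theorem slln_random_mixture (ρ : ℝ) (hρ : 0 < ρ) (N : ℕ) (hN : 2 ≤ N)
    (γ : ℝ) (hγ0 : 0 < γ) (hγ1 : γ < 1)
    -- game B transition matrix on Σ_N = (ℤ/3ℤ)^N
    (PB : Matrix (Fin N → ZMod 3) (Fin N → ZMod 3) ℝ)
    (hPBwin : ∀ (x y : Fin N → ZMod 3) (i : Fin N), y i = x i + 1 →
      (∀ j, j ≠ i → y j = x j) →
      PB x y = (if x i = 0 then ρ ^ 2 / (1 + ρ ^ 2) else 1 / (1 + ρ)) / N)
    (hPBlose : ∀ (x y : Fin N → ZMod 3) (i : Fin N), y i = x i - 1 →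
      (∀ j, j ≠ i → y j = x j) →
      PB x y = (1 - (if x i = 0 then ρ ^ 2 / (1 + ρ ^ 2) else 1 / (1 + ρ))) / N)
    (hPBzero : ∀ x y : Fin N → ZMod 3,
      (¬ ∃ i, (y i = x i + 1 ∨ y i = x i - 1) ∧ ∀ j, j ≠ i → y j = x j) → PB x y = 0)
    -- game A' (redistribution) transition matrix on Σ_N
    (PA : Matrix (Fin N → ZMod 3) (Fin N → ZMod 3) ℝ)
    (hPAone : ∀ (x y : Fin N → ZMod 3) (i j : Fin N), i ≠ j →
      y i = x i - 1 → y j = x j + 1 → (∀ k, k ≠ i → k ≠ j → y k = x k) →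
      PA x y = 1 / ((N : ℝ) * ((N : ℝ) - 1)))
    (hPAzero : ∀ x y : Fin N → ZMod 3,
      (¬ ∃ i j, i ≠ j ∧ y i = x i - 1 ∧ y j = x j + 1 ∧ ∀ k, k ≠ i → k ≠ j → y k = x k) →
      PA x y = 0)
    -- the payoff function
    (w : (Fin N → ZMod 3) → (Fin N → ZMod 3) → ℝ)
    (hwwin : ∀ (x y : Fin N → ZMod 3) (i : Fin N), y i = x i + 1 →
      (∀ j, j ≠ i → y j = x j) → w x y = 1)
    (hwlose : ∀ (x y : Fin N → ZMod 3) (i : Fin N), y i = x i - 1 →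
      (∀ j, j ≠ i → y j = x j) → w x y = -1)
    (hwzero : ∀ x y : Fin N → ZMod 3,
      (¬ ∃ i, (y i = x i + 1 ∨ y i = x i - 1) ∧ ∀ j, j ≠ i → y j = x j) → w x y = 0)
    -- the Markov chain: canonical coordinate process under `μ`, with arbitrary
    -- initial distribution and one-step transition matrix `γ PA + (1−γ) PB`
    (μ : Measure (ℕ → (Fin N → ZMod 3))) [IsProbabilityMeasure μ]
    (hMarkov : ∀ (n : ℕ) (f : ℕ → (Fin N → ZMod 3)) (y : Fin N → ZMod 3),
      μ {ω | (∀ i ≤ n, ω i = f i) ∧ ω (n + 1) = y}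
        = μ {ω | ∀ i ≤ n, ω i = f i}
          * ENNReal.ofReal ((γ • PA + (1 - γ) • PB) (f n) y)) :
    (∀ᵐ ω ∂μ, Tendsto
        (fun n : ℕ => (∑ m ∈ Finset.range n, w (ω m) (ω (m + 1))) / (n : ℝ)) atTop
        (nhds (3 * γ * (1 - γ) * (1 - ρ) ^ 3 * (1 + ρ) /
          (2 * (1 + ρ + ρ ^ 2) ^ 2 + γ * (5 + 10 * ρ + 6 * ρ ^ 2 + 10 * ρ ^ 3 + 5 * ρ ^ 4)
            + 2 * γ ^ 2 * (1 + ρ + ρ ^ 2) ^ 2)))) ∧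
    (ρ < 1 → 0 < 3 * γ * (1 - γ) * (1 - ρ) ^ 3 * (1 + ρ) /
          (2 * (1 + ρ + ρ ^ 2) ^ 2 + γ * (5 + 10 * ρ + 6 * ρ ^ 2 + 10 * ρ ^ 3 + 5 * ρ ^ 4)
            + 2 * γ ^ 2 * (1 + ρ + ρ ^ 2) ^ 2)) := by
  refine ⟨?_, ?_⟩
  swap
  · intro h1
    have : 0 < 1 - ρ := by linarith
    have : 0 < 1 - γ := by linarith
    positivity
  obtain ⟨g, hg⟩ := aux_poisson ρ hρ γ hγ0 hγ1
  set c : ℝ := 3 * γ * (1 - γ) * (1 - ρ) ^ 3 * (1 + ρ) /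
          (2 * (1 + ρ + ρ ^ 2) ^ 2 + γ * (5 + 10 * ρ + 6 * ρ ^ 2 + 10 * ρ ^ 3 + 5 * ρ ^ 4)
            + 2 * γ ^ 2 * (1 + ρ + ρ ^ 2) ^ 2) with hc
  clear_value c
  obtain ⟨p, hp⟩ : ∃ p : ZMod 3 → ℝ,
      p = fun s => if s = 0 then ρ ^ 2 / (1 + ρ ^ 2) else 1 / (1 + ρ) := ⟨_, rfl⟩
  have hp' : ∀ s, (if s = 0 then ρ ^ 2 / (1 + ρ ^ 2) else 1 / (1 + ρ)) = p s := by simp [hp]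
  simp only [hp'] at hg hPBwin hPBlose
  have hp01 : ∀ s, 0 ≤ p s ∧ 0 ≤ 1 - p s := by
    intro s
    rw [hp]
    have h1 : ρ ^ 2 / (1 + ρ ^ 2) ≤ 1 := by rw [div_le_one (by positivity)]; linarith
    have h2 : 1 / (1 + ρ) ≤ 1 := by rw [div_le_one (by positivity)]; linarith
    simp only
    split_ifs
    · exact ⟨by positivity, by linarith⟩
    · exact ⟨by positivity, by linarith⟩
  have hNr : (2 : ℝ) ≤ N := by exact_mod_cast hN
  have hN0 : (0 : ℝ) < N := by linarith
  have hN1 : (0 : ℝ) < (N : ℝ) - 1 := by linarith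
  have g1 : 0 < 1 - γ := by linarith
  have hB := aux_sumB p PB hPBwin hPBlose hPBzero
  have hA := aux_sumA PA hPAone hPAzero
  have hP0 : ∀ x y, 0 ≤ (γ • PA + (1 - γ) • PB) x y := by
    intro x y
    have hA0 : 0 ≤ PA x y := by
      by_cases h : ∃ i j, i ≠ j ∧ y i = x i - 1 ∧ y j = x j + 1 ∧ ∀ k, k ≠ i → k ≠ j → y k = x k
      · obtain ⟨i, j, h1, h2, h3, h4⟩ := h
        rw [hPAone x y i j h1 h2 h3 h4]; positivity
      · rw [hPAzero x y h]
    have hB0 : 0 ≤ PB x y := by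
      by_cases h : ∃ i, (y i = x i + 1 ∨ y i = x i - 1) ∧ ∀ j, j ≠ i → y j = x j
      · obtain ⟨i, h1 | h1, h2⟩ := h
        · rw [hPBwin x y i h1 h2]; exact div_nonneg (hp01 _).1 hN0.le
        · rw [hPBlose x y i h1 h2]; exact div_nonneg (hp01 _).2 hN0.le
      · rw [hPBzero x y h]
    simp only [Matrix.add_apply, Matrix.smul_apply, smul_eq_mul]
    positivity
  let h : (Fin N → ZMod 3) → ℝ := fun x => ∑ k, g (x k)
  let D : (Fin N → ZMod 3) → (Fin N → ZMod 3) → ℝ := fun x y => w x y + (h y - h x) - c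
  have hwA : ∀ (x : Fin N → ZMod 3) (i j : Fin N), i ≠ j → w x (auxA x i j) = 0 := by
    intro x i j hij
    apply hwzero
    rintro ⟨k, -, hk⟩
    by_cases hki : k = i
    · have := hk j (by rw [hki]; exact hij.symm)
      rw [auxA_j] at this
      exact aux_z1 _ this
    · have := hk i (Ne.symm hki)
      rw [auxA_i x hij] at this
      exact aux_z2 _ this
  have hhA : ∀ (x : Fin N → ZMod 3) (i j : Fin N), i ≠ j → h (auxA x i j) - h x =
      (g (x i - 1) - g (x i)) + (g (x j + 1) - g (x j)) := by
    intro x i j hij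
    have h1 := aux_h1 g x i (x i - 1)
    have h2 := aux_h1 g (Function.update x i (x i - 1)) j (x j + 1)
    rw [Function.update_of_ne hij.symm] at h2
    simp only [h, auxA]
    linarith
  have hDz : ∀ x, ∑ y, (γ • PA + (1 - γ) • PB) x y * D x y = 0 := by
    intro x
    have eA : ∑ y, PA x y * D x y =
        ∑ i, (1 / (N : ℝ)) * ((g (x i - 1) - g (x i)) + (g (x i + 1) - g (x i)) - c) := by
      rw [hA]
      have h1 : ∀ q ∈ (Finset.univ : Finset (Fin N)).offDiag,
          1 / ((N : ℝ) * ((N : ℝ) - 1)) * D x (auxA x q.1 q.2) =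
          1 / ((N : ℝ) * ((N : ℝ) - 1)) * ((g (x q.1 - 1) - g (x q.1) - c)
            + (g (x q.2 + 1) - g (x q.2))) := by
        intro q hq
        have hq' : q.1 ≠ q.2 := by simpa using hq
        simp only [D]
        rw [hwA x _ _ hq', hhA x _ _ hq']
        ring
      rw [Finset.sum_congr rfl h1, ← Finset.mul_sum,
        aux_off (fun i => g (x i - 1) - g (x i) - c) (fun i => g (x i + 1) - g (x i)),
        ← mul_assoc, Finset.mul_sum]
      refine Finset.sum_congr rfl fun i _ => ?_
      field_simp
      ring
    have eB : ∑ y, PB x y * D x y =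
        ∑ i, (1 / (N : ℝ)) * (p (x i) * (1 + (g (x i + 1) - g (x i)))
          + (1 - p (x i)) * (-1 + (g (x i - 1) - g (x i))) - c) := by
      rw [hB]
      refine Finset.sum_congr rfl fun i _ => ?_
      simp only [D, h]
      rw [aux_h1, aux_h1, hwwin x _ i (by simp) (fun j hj => by simp [hj]),
        hwlose x _ i (by simp) (fun j hj => by simp [hj])]
      ring
    simp only [Matrix.add_apply, Matrix.smul_apply, smul_eq_mul, add_mul, mul_assoc,
      Finset.sum_add_distrib]
    rw [← Finset.mul_sum, ← Finset.mul_sum, eA, eB, Finset.mul_sum, Finset.mul_sum,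
      ← Finset.sum_add_distrib]
    refine Finset.sum_eq_zero fun i _ => ?_
    have := hg (x i)
    linear_combination (1 / (N : ℝ)) * this
  have hmain := aux_slln (γ • PA + (1 - γ) • PB) D hP0 hDz μ hMarkov
  obtain ⟨K, hK⟩ : ∃ K : ℝ, ∀ x, |h x| ≤ K := by
    refine ⟨∑ x, |h x|, fun x => ?_⟩
    exact Finset.single_le_sum (f := fun x => |h x|) (fun _ _ => abs_nonneg _) (Finset.mem_univ x)
  filter_upwards [hmain] with ω hω
  have ht : Tendsto (fun n : ℕ => (h (ω n) - h (ω 0)) / (n : ℝ)) atTop (nhds 0) := by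
    refine squeeze_zero_norm (a := fun n : ℕ => (2 * K) / (n : ℝ)) (fun n => ?_)
      (tendsto_const_div_atTop_nhds_zero_nat _)
    rw [norm_div, Real.norm_natCast]
    refine div_le_div_of_nonneg_right ?_ (Nat.cast_nonneg n)
    have h1 := abs_le.1 (hK (ω n))
    have h2 := abs_le.1 (hK (ω 0))
    rw [Real.norm_eq_abs, abs_le]
    constructor <;> linarith
  have hfin := (hω.sub ht).add_const c
  rw [sub_zero, zero_add] at hfin
  refine hfin.congr' ?_
  filter_upwards [eventually_gt_atTop 0] with n hn
  have hn' : (0 : ℝ) < n := by exact_mod_cast hn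
  have hsum : ∑ m ∈ Finset.range n, D (ω m) (ω (m + 1)) =
      ∑ m ∈ Finset.range n, w (ω m) (ω (m + 1)) + (h (ω n) - h (ω 0)) - n * c := by
    simp only [D]
    rw [Finset.sum_sub_distrib, Finset.sum_add_distrib,
      Finset.sum_range_sub (fun m => h (ω m))]
    simp
  rw [hsum]
  field_simp
  ring
end

section
/- Let Σ be a finite set, P a row-stochastic matrix indexed by Σ with stationary distribution π, Π the matrix each of whose rows equals π, and assume I − (P − Π) is invertible with Z_P := (I − (P − Π))⁻¹. Let W be a matrix indexed by Σ with zero diagonal, set Ṗ := P∘W and P̈ := P∘W∘W, and assume πṖ1 = 0. For an integer N ≥ 1 let P_N := (1/N)P + (1 − 1/N)I, with fundamental matrix Z_{P_N} := (I − (P_N − Π))⁻¹ (which exists). Then π((1/N)P̈)1 + 2π((1/N)Ṗ)(Z_{P_N} − Π)((1/N)Ṗ)1 = N⁻¹[πP̈1 + 2πṖ(Z_P − Π)Ṗ1]; that is, the variance parameter of the lazy chain P_N with payoffs concentrated on the P-moves equals N⁻¹ times the variance parameter of P. -/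
open Matrix

/-- the variance parameter of the lazy chain `P_N = (1/N)P + (1−1/N)I`
with payoffs concentrated on the `P`-moves equals `N⁻¹` times the variance parameter
of `P`. -/
theorem variance_lazy_chain
    {S : Type*} [Fintype S] [DecidableEq S]
    (P : Matrix S S ℝ) (hP0 : ∀ i j, 0 ≤ P i j) (hProw : ∀ i, ∑ j, P i j = 1)
    (π : S → ℝ) (hπ0 : ∀ i, 0 ≤ π i) (hπ1 : ∑ i, π i = 1)
    (hπP : ∀ j, ∑ i, π i * P i j = π j)
    (Pim : Matrix S S ℝ) (hPim : ∀ i j, Pim i j = π j)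
    (hinv : IsUnit (1 - (P - Pim)))
    (W : Matrix S S ℝ) (hW : ∀ i, W i i = 0)
    (hmean : π ⬝ᵥ ((Matrix.of fun i j => P i j * W i j) *ᵥ (fun _ => 1)) = 0)
    (N : ℕ) (hN : 1 ≤ N) :
    π ⬝ᵥ (((N : ℝ)⁻¹ • Matrix.of fun i j => P i j * W i j * W i j) *ᵥ (fun _ => 1))
      + 2 * (π ⬝ᵥ ((((N : ℝ)⁻¹ • Matrix.of fun i j => P i j * W i j)
          * ((1 - (((N : ℝ)⁻¹ • P + (1 - (N : ℝ)⁻¹) • (1 : Matrix S S ℝ)) - Pim))⁻¹ - Pim)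
          * ((N : ℝ)⁻¹ • Matrix.of fun i j => P i j * W i j)) *ᵥ (fun _ => 1)))
      = (N : ℝ)⁻¹ *
        (π ⬝ᵥ ((Matrix.of fun i j => P i j * W i j * W i j) *ᵥ (fun _ => 1))
          + 2 * (π ⬝ᵥ (((Matrix.of fun i j => P i j * W i j)
              * ((1 - (P - Pim))⁻¹ - Pim)
              * (Matrix.of fun i j => P i j * W i j)) *ᵥ (fun _ => 1)))) := by
  have hN0 : (N : ℝ) ≠ 0 := by
    have : N ≠ 0 := by omega
    exact_mod_cast this
  have hPP : Pim * P = Pim := by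
    ext i j
    simp only [Matrix.mul_apply, hPim, hπP]
  have hPP' : P * Pim = Pim := by
    ext i j
    simp only [Matrix.mul_apply, hPim]
    rw [← Finset.sum_mul, hProw, one_mul]
  have hQQ : Pim * Pim = Pim := by
    ext i j
    simp only [Matrix.mul_apply, hPim]
    rw [← Finset.sum_mul, hπ1, one_mul]
  have hdet : IsUnit (1 - (P - Pim)).det := (Matrix.isUnit_iff_isUnit_det _).1 hinv
  have hZ : (1 - (P - Pim)) * (1 - (P - Pim))⁻¹ = 1 := Matrix.mul_nonsing_inv _ hdet
  generalize (1 - (P - Pim))⁻¹ = Z at hZ ⊢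
  have hQZ : Pim * Z = Pim := by
    have h : Pim * (1 - (P - Pim)) = Pim := by
      rw [mul_sub, mul_sub, hPP, hQQ, mul_one, sub_self, sub_zero]
    calc Pim * Z = Pim * (1 - (P - Pim)) * Z := by rw [h]
      _ = Pim := by rw [mul_assoc, hZ, mul_one]
  have hPZ : (1 - P) * Z = 1 - Pim := by
    have h : (1 - P) * Z + Pim * Z = 1 := by
      refine Eq.trans ?_ hZ
      noncomm_ring
    rw [hQZ] at h
    exact eq_sub_of_add_eq h
  have hP1 : (1 - P) * Pim = 0 := by
    rw [sub_mul, hPP', one_mul, sub_self]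
  have hinvN : (1 - (((N : ℝ)⁻¹ • P + (1 - (N : ℝ)⁻¹) • (1 : Matrix S S ℝ)) - Pim))⁻¹
      = (N : ℝ) • (Z - Pim) + Pim := by
    apply Matrix.inv_eq_right_inv
    have h : (1 - (((N : ℝ)⁻¹ • P + (1 - (N : ℝ)⁻¹) • (1 : Matrix S S ℝ)) - Pim))
        = (N : ℝ)⁻¹ • (1 - P) + Pim := by
      module
    rw [h, add_mul, mul_add, mul_add, smul_mul_assoc, mul_smul_comm, smul_smul,
      inv_mul_cancel₀ hN0, one_smul, smul_mul_assoc, hP1, mul_smul_comm, mul_sub, mul_sub,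
      hP1, hPZ, hQZ, hQQ]
    simp
  rw [hinvN, add_sub_cancel_right]
  simp only [smul_mul_assoc, mul_smul_comm, smul_mulVec, dotProduct_smul, smul_eq_mul]
  field_simp
end
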